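/- For k ≥ 2 and n sufficiently large, if G attains the maximum spectral radius among n-vertex graphs containing no k edge-disjoint triangles, then G is obtained from K_{⌊n/2⌋,⌈n/2⌉} by embedding a graph H with k−1 edges in the part of size ⌊n/2⌋, where H ≅ C₃ if k = 4 and H ≅ K_{1,k−1} otherwise; in particular e(G) = ⌊n²/4⌋ + k − 1. -/

import Mathlib

open Classical in
/-- Adjacency matrix of a simple graph over ℝ. -/
noncomputable def adjMat {V : Type*} [Fintype V] (G : SimpleGraph V) : Matrix V V ℝ :=
  Matrix.of fun i j => if G.Adj i j then (1 : ℝ) else 0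

/-- Spectral radius: largest adjacency eigenvalue. -/
noncomputable def specRad {V : Type*} [Fintype V] (G : SimpleGraph V) : ℝ :=
  sSup {t : ℝ | ∃ x : V → ℝ, x ≠ 0 ∧ (adjMat G).mulVec x = t • x}

/-- `G` contains two edge-disjoint cycles. -/
def HasTwoEdgeDisjointCycles {V : Type*} (G : SimpleGraph V) : Prop :=
  ∃ (u v : V) (c₁ : G.Walk u u) (c₂ : G.Walk v v),
    c₁.IsCycle ∧ c₂.IsCycle ∧ ∀ e ∈ c₁.edges, e ∉ c₂.edges

/-- `G` contains two distinct cycles (as subgraphs) of the same length. -/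
def HasTwoCyclesSameLength {V : Type*} [DecidableEq V] (G : SimpleGraph V) : Prop :=
  ∃ (u v : V) (c₁ : G.Walk u u) (c₂ : G.Walk v v),
    c₁.IsCycle ∧ c₂.IsCycle ∧ c₁.length = c₂.length ∧
      c₁.edges.toFinset ≠ c₂.edges.toFinset

/-- The edge set of a triangle given by a triple of vertices. -/
def triEdges {V : Type*} (t : V × V × V) : Set (Sym2 V) :=
  {s(t.1, t.2.1), s(t.2.1, t.2.2), s(t.1, t.2.2)}

/-- `G` contains `k` pairwise edge-disjoint triangles. -/
def HasEdgeDisjointTriangles {V : Type*} (G : SimpleGraph V) (k : ℕ) : Prop :=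
  ∃ T : Fin k → V × V × V,
    (∀ i, G.Adj (T i).1 (T i).2.1 ∧ G.Adj (T i).2.1 (T i).2.2 ∧ G.Adj (T i).1 (T i).2.2) ∧
    ∀ i j, i ≠ j → Disjoint (triEdges (T i)) (triEdges (T j))

/-- The star `K_{1,n-1}` (center `0`) plus an edge between the leaves `1` and `2`. -/
def starPlus (n : ℕ) : SimpleGraph (Fin n) :=
  SimpleGraph.fromRel (fun x y => x.val = 0 ∨ (x.val < 3 ∧ y.val < 3))

/-- `K₄ • K_{1,n-4}`: `K₄` on `{0,1,2,3}` with `0` joined to everything. -/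
def K4Star (n : ℕ) : SimpleGraph (Fin n) :=
  SimpleGraph.fromRel (fun x y => x.val = 0 ∨ (x.val < 4 ∧ y.val < 4))

/-- `K_{3,3} • K_{1,n-6}`: `K_{3,3}` with parts `{0,1,2}`, `{3,4,5}`, and the vertex `0`
identified with the center of a star with leaves `6,…,n-1`. -/
def K33Star (n : ℕ) : SimpleGraph (Fin n) :=
  SimpleGraph.fromRel (fun x y =>
    (x.val < 3 ∧ 3 ≤ y.val ∧ y.val < 6) ∨ (x.val = 0 ∧ 6 ≤ y.val))

/-- `K_{⌈n/2⌉,⌊n/2⌋}` with a star `K_{1,k-1}` (center `0`, leaves `1,…,k-1`) embedded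
in the part `{0,…,⌊n/2⌋-1}` of size `⌊n/2⌋`. -/
def bipStar (n k : ℕ) : SimpleGraph (Fin n) :=
  SimpleGraph.fromRel (fun x y =>
    (x.val < n / 2 ∧ n / 2 ≤ y.val) ∨ (x.val = 0 ∧ 0 < y.val ∧ y.val < k))

/-- `K_{⌈n/2⌉,⌊n/2⌋}` with a triangle `C₃` on `{0,1,2}` embedded in the part of size `⌊n/2⌋`. -/
def bipTri (n : ℕ) : SimpleGraph (Fin n) :=
  SimpleGraph.fromRel (fun x y =>
    (x.val < n / 2 ∧ n / 2 ≤ y.val) ∨ (x.val < 3 ∧ y.val < 3))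

/-- `v` is a cut vertex of `G`. -/
def IsCutVertex {V : Type*} (G : SimpleGraph V) (v : V) : Prop :=
  ∃ a b : ({v}ᶜ : Set V), G.Reachable ↑a ↑b ∧ ¬ (G.induce ({v}ᶜ : Set V)).Reachable a b

section

open scoped Classical
open Finset

variable {V : Type*} [Fintype V]

/-- The sum of `x` over the neighbours of `v`. -/
noncomputable def nbrSum (G : SimpleGraph V) (x : V → ℝ) (v : V) : ℝ :=
  ∑ w, if G.Adj v w then x w else 0

/-- The quadratic form of the adjacency matrix. -/
noncomputable def quadForm (G : SimpleGraph V) (x : V → ℝ) : ℝ :=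
  ∑ v, ∑ w, if G.Adj v w then x v * x w else 0

lemma adjMat_mulVec (G : SimpleGraph V) (x : V → ℝ) (v : V) :
    (adjMat G).mulVec x v = nbrSum G x v := by
  simp [adjMat, nbrSum, Matrix.mulVec, dotProduct]

lemma quadForm_eq (G : SimpleGraph V) (x : V → ℝ) :
    quadForm G x = ∑ v, x v * nbrSum G x v := by
  simp [quadForm, nbrSum, mul_sum]

lemma quadForm_smul (G : SimpleGraph V) (x : V → ℝ) (c : ℝ) :
    quadForm G (c • x) = c ^ 2 * quadForm G x := by
  simp only [quadForm, mul_sum]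
  refine sum_congr rfl fun v _ => sum_congr rfl fun w _ => ?_
  split_ifs
  · simp only [Pi.smul_apply, smul_eq_mul]; ring
  · simp

lemma quadForm_add (G : SimpleGraph V) (x z : V → ℝ) :
    quadForm G (x + z) = quadForm G x + 2 * (∑ v, z v * nbrSum G x v) + quadForm G z := by
  have hsymm : ∑ v, z v * nbrSum G x v = ∑ v, x v * nbrSum G z v := by
    simp only [nbrSum, mul_sum]
    rw [sum_comm]
    refine sum_congr rfl fun v _ => sum_congr rfl fun w _ => ?_
    simp only [G.adj_comm w v]
    split_ifs <;> ring
  have hadd : ∀ v, nbrSum G (x + z) v = nbrSum G x v + nbrSum G z v := by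
    intro v
    simp only [nbrSum, ← sum_add_distrib]
    refine sum_congr rfl fun w _ => ?_
    split_ifs <;> simp
  rw [two_mul]
  nth_rewrite 2 [hsymm]
  simp only [quadForm_eq, ← sum_add_distrib, hadd]
  refine sum_congr rfl fun v _ => ?_
  simp only [Pi.add_apply]
  ring

lemma continuous_quadForm (G : SimpleGraph V) : Continuous (quadForm G) := by
  unfold quadForm
  refine continuous_finsetSum _ fun v _ => continuous_finsetSum _ fun w _ => ?_
  split_ifs <;> fun_prop

/-- A maximizer of the Rayleigh quotient is an eigenvector. -/
lemma nbrSum_eq_of_quadForm_eq {G : SimpleGraph V} {l : ℝ}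
    (hl : ∀ y, quadForm G y ≤ l * ∑ v, y v ^ 2) {x : V → ℝ}
    (hx : quadForm G x = l * ∑ v, x v ^ 2) (v : V) : nbrSum G x v = l * x v := by
  set z : V → ℝ := fun v => nbrSum G x v - l * x v with hz
  have key : ∀ t : ℝ, 2 * t * (∑ v, z v ^ 2) + t ^ 2 * (quadForm G z - l * ∑ v, z v ^ 2) ≤ 0 := by
    intro t
    have h := hl (x + t • z)
    rw [quadForm_add, quadForm_smul, hx] at h
    have e1 : ∑ v, (x + t • z) v ^ 2
        = ∑ v, x v ^ 2 + 2 * t * ∑ v, z v * x v + t ^ 2 * ∑ v, z v ^ 2 := by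
      simp only [mul_sum, ← sum_add_distrib, Pi.add_apply, Pi.smul_apply, smul_eq_mul]
      exact sum_congr rfl fun v _ => by ring
    have e2 : ∑ v, (t • z) v * nbrSum G x v
        = t * (∑ v, z v ^ 2) + t * l * ∑ v, z v * x v := by
      simp only [mul_sum, ← sum_add_distrib, Pi.smul_apply, smul_eq_mul]
      exact sum_congr rfl fun v _ => by simp only [hz]; ring
    rw [e1, e2] at h
    nlinarith
  set s := ∑ v, z v ^ 2 with hs
  set q := quadForm G z - l * s
  have hs0 : 0 ≤ s := sum_nonneg fun v _ => sq_nonneg _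
  have hs1 : s = 0 := by
    by_contra hne
    have hpos : 0 < s := lt_of_le_of_ne hs0 (Ne.symm hne)
    have hq : 0 < |q| + 1 := by positivity
    have h := key (s / (|q| + 1))
    have h2 : (s / (|q| + 1)) ^ 2 * q ≥ -((s / (|q| + 1)) * s) := by
      have : (s / (|q| + 1)) ^ 2 * (|q| + 1) = (s / (|q| + 1)) * s := by field_simp
      nlinarith [neg_abs_le q, sq_nonneg (s / (|q| + 1))]
    have h3 : 0 < s / (|q| + 1) * s := by positivity
    nlinarith
  have := (sum_eq_zero_iff_of_nonneg (fun v _ => sq_nonneg (z v))).1 hs1 v (mem_univ v)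
  have : z v = 0 := by simpa using this
  simp only [hz] at this
  linarith

/-- The Rayleigh principle together with the existence of a nonnegative eigenvector. -/
theorem specRad_spec [Nonempty V] (G : SimpleGraph V) :
    (∀ y : V → ℝ, quadForm G y ≤ specRad G * ∑ v, y v ^ 2) ∧
      ∃ x : V → ℝ, (∀ v, 0 ≤ x v) ∧ x ≠ 0 ∧ ∀ v, nbrSum G x v = specRad G * x v := by
  have hcpt : IsCompact {y : V → ℝ | ∑ v, y v ^ 2 = 1} := by
    refine Metric.isCompact_of_isClosed_isBounded
      (isClosed_eq (by fun_prop) continuous_const) ?_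
    refine (Metric.isBounded_closedBall (x := (0 : V → ℝ)) (r := 1)).subset fun y hy => ?_
    rw [mem_closedBall_zero_iff, pi_norm_le_iff_of_nonneg zero_le_one]
    intro v
    have h1 : y v ^ 2 ≤ ∑ v, y v ^ 2 :=
      single_le_sum (f := fun v => y v ^ 2) (fun v _ => sq_nonneg _) (mem_univ v)
    rw [Set.mem_ofPred_eq] at hy
    rw [Real.norm_eq_abs]
    exact abs_le_one_iff_mul_self_le_one.2 (by nlinarith)
  have hne : {y : V → ℝ | ∑ v, y v ^ 2 = 1}.Nonempty := by
    obtain ⟨v⟩ := ‹Nonempty V›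
    exact ⟨Pi.single v 1, by simp [Pi.single_apply]⟩
  obtain ⟨x₀, hx₀, hmax⟩ := hcpt.exists_isMaxOn hne (continuous_quadForm G).continuousOn
  set l := quadForm G x₀ with hl
  have hR : ∀ y : V → ℝ, quadForm G y ≤ l * ∑ v, y v ^ 2 := by
    intro y
    set s := ∑ v, y v ^ 2 with hs
    have hs0 : 0 ≤ s := sum_nonneg fun v _ => sq_nonneg _
    rcases hs0.eq_or_lt with h0 | hpos
    · have hy : ∀ v, y v = 0 := fun v => by
        simpa using (sum_eq_zero_iff_of_nonneg (fun v _ => sq_nonneg (y v))).1 h0.symm v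
          (mem_univ v)
      simp [quadForm, hy, ← h0]
    · have hmem : (1 / √s) • y ∈ {y : V → ℝ | ∑ v, y v ^ 2 = 1} := by
        simp only [Set.mem_ofPred_eq, Pi.smul_apply, smul_eq_mul, mul_pow, ← mul_sum, ← hs,
          div_pow, Real.sq_sqrt hs0]
        field_simp
      have h := hmax hmem
      simp only [Set.mem_ofPred_eq, quadForm_smul, div_pow, Real.sq_sqrt hs0, one_pow] at h
      rw [one_div, inv_mul_le_iff₀ hpos] at h
      linarith
  set x : V → ℝ := fun v => |x₀ v| with hx
  have hsq : ∑ v, x v ^ 2 = 1 := by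
    simpa [hx] using hx₀
  have hxl : quadForm G x = l * ∑ v, x v ^ 2 := by
    refine le_antisymm (hR x) ?_
    rw [hsq, mul_one, hl]
    refine sum_le_sum fun v _ => sum_le_sum fun w _ => ?_
    split_ifs
    · simp only [hx, ← abs_mul]; exact le_abs_self _
    · exact le_rfl
  have hx0 : x ≠ 0 := by
    rintro h0
    simp [h0] at hsq
  have heig := nbrSum_eq_of_quadForm_eq hR hxl
  have hspec : specRad G = l := by
    refine IsGreatest.csSup_eq ⟨⟨x, hx0, ?_⟩, ?_⟩
    · ext v
      rw [adjMat_mulVec, heig]; rfl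
    · rintro t ⟨y, hy0, hy⟩
      have h1 : ∀ v, nbrSum G y v = t * y v := fun v => by
        rw [← adjMat_mulVec, hy]; rfl
      have h2 := hR y
      have h3 : quadForm G y = t * ∑ v, y v ^ 2 := by
        rw [quadForm_eq, mul_sum]
        exact sum_congr rfl fun v _ => by rw [h1]; ring
      have h4 : 0 < ∑ v, y v ^ 2 := by
        obtain ⟨v, hv⟩ := Function.ne_iff.1 hy0
        exact sum_pos' (fun v _ => sq_nonneg _)
          ⟨v, mem_univ v, by have : y v ≠ 0 := hv; positivity⟩
      rw [h3] at h2
      exact le_of_mul_le_mul_right h2 h4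
  rw [hspec]
  exact ⟨hR, x, fun v => abs_nonneg _, hx0, heig⟩

/-- Adding edges strictly increases the spectral radius, given a positive eigenvector. -/
lemma eq_of_le_of_specRad_le [Nonempty V] {G G' : SimpleGraph V} {x : V → ℝ}
    (hx : ∀ v, 0 < x v) (heig : ∀ v, nbrSum G x v = specRad G * x v) (hle : G ≤ G')
    (hs : specRad G' ≤ specRad G) : G = G' := by
  refine le_antisymm hle fun a b hab => ?_
  by_contra hG
  have h1 : quadForm G x = specRad G * ∑ v, x v ^ 2 := by
    rw [quadForm_eq, mul_sum]
    exact sum_congr rfl fun v _ => by rw [heig]; ring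
  have hterm : ∀ v w, (if G.Adj v w then x v * x w else 0) ≤
      if G'.Adj v w then x v * x w else 0 := by
    intro v w
    have : 0 < x v * x w := mul_pos (hx v) (hx w)
    by_cases h : G.Adj v w
    · simp [h, hle h]
    · simp only [h, if_false]; split_ifs <;> linarith
  have h2 : quadForm G x < quadForm G' x := by
    refine sum_lt_sum (fun v _ => sum_le_sum fun w _ => hterm v w) ⟨a, mem_univ a, ?_⟩
    refine sum_lt_sum (fun w _ => hterm a w) ⟨b, mem_univ b, ?_⟩
    simp [hG, hab, mul_pos (hx a) (hx b)]
  have h3 := (specRad_spec G').1 x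
  have h4 : 0 ≤ ∑ v, x v ^ 2 := sum_nonneg fun v _ => sq_nonneg _
  nlinarith

/-- The graph obtained from `G` by making `I` (without `v`) the neighbourhood of `v`. -/
def reattach (G : SimpleGraph V) (v : V) (I : Finset V) : SimpleGraph V where
  Adj a b := (a ≠ v ∧ b ≠ v ∧ G.Adj a b) ∨ (a = v ∧ b ≠ v ∧ b ∈ I) ∨ (b = v ∧ a ≠ v ∧ a ∈ I)
  symm := ⟨fun a b h => by
    have := G.adj_comm a b
    tauto⟩
  loopless := ⟨fun a h => by
    have := G.loopless.irrefl a
    tauto⟩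

lemma sum_sum_split {F : V → V → ℝ} (v : V) (hsymm : ∀ a b, F a b = F b a) (h0 : F v v = 0) :
    ∑ a, ∑ b, F a b = 2 * ∑ b, F v b + ∑ a ∈ univ.erase v, ∑ b ∈ univ.erase v, F a b := by
  rw [← add_sum_erase univ _ (mem_univ v)]
  have h1 : ∀ a, ∑ b, F a b = F v a + ∑ b ∈ univ.erase v, F a b := fun a => by
    rw [← add_sum_erase univ _ (mem_univ v), hsymm a v]
  have h2 : ∑ a ∈ univ.erase v, ∑ b, F a b = ∑ a ∈ univ.erase v, F v a
      + ∑ a ∈ univ.erase v, ∑ b ∈ univ.erase v, F a b := by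
    rw [← sum_add_distrib]
    exact sum_congr rfl fun a _ => h1 a
  have h3 := add_sum_erase univ (F v) (mem_univ v)
  rw [h2]
  linarith

/-- If reattaching `v` does not increase the spectral radius, then the weight of `v` is large. -/
lemma sum_le_of_specRad_reattach_le [Nonempty V] {G : SimpleGraph V} {x : V → ℝ}
    (hx : ∀ v, 0 ≤ x v) (hpos : 0 < specRad G)
    (heig : ∀ v, nbrSum G x v = specRad G * x v) (v : V) (I : Finset V)
    (hs : specRad (reattach G v I) ≤ specRad G) :
    ∑ w ∈ I.erase v, x w ≤ specRad G * x v := by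
  set r := specRad G with hr
  set σ := ∑ w ∈ I.erase v, x w with hσ
  set G' := reattach G v I with hG'
  have hσ0 : 0 ≤ σ := sum_nonneg fun w _ => hx w
  set z : V → ℝ := Function.update x v (σ / r) with hz
  have hzv : z v = σ / r := by simp [hz]
  have hzw : ∀ w, w ≠ v → z w = x w := fun w hw => by simp [hz, hw]
  have q1 : quadForm G x = r * ∑ w, x w ^ 2 := by
    rw [quadForm_eq, mul_sum]
    exact sum_congr rfl fun v _ => by rw [heig]; ring
  have q2 := sum_sum_split (F := fun a b => if G.Adj a b then x a * x b else 0) v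
    (fun a b => by simp only [G.adj_comm a b, mul_comm]) (by simp)
  have q3 := sum_sum_split (F := fun a b => if G'.Adj a b then z a * z b else 0) v
    (fun a b => by simp only [G'.adj_comm a b, mul_comm]) (by simp)
  have e1 : ∑ b, (if G.Adj v b then x v * x b else 0) = r * x v ^ 2 := by
    have := heig v
    rw [nbrSum] at this
    calc _ = x v * ∑ b, (if G.Adj v b then x b else 0) := by simp [mul_sum]
      _ = _ := by rw [this]; ring
  have e2 : ∑ b, (if G'.Adj v b then z v * z b else 0) = σ ^ 2 / r := by
    have : ∑ b, (if G'.Adj v b then z v * z b else 0)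
        = ∑ b, if b ∈ I.erase v then σ / r * x b else 0 := by
      refine sum_congr rfl fun b _ => ?_
      by_cases hb : b = v
      · subst hb; simp
      · simp [hG', reattach, hb, hzv, hzw b hb]
    rw [this, ← sum_filter, ← mul_sum, filter_mem_eq_inter, univ_inter, ← hσ]
    ring
  have e3 : ∑ a ∈ univ.erase v, ∑ b ∈ univ.erase v, (if G'.Adj a b then z a * z b else 0)
      = ∑ a ∈ univ.erase v, ∑ b ∈ univ.erase v, (if G.Adj a b then x a * x b else 0) := by
    refine sum_congr rfl fun a ha => sum_congr rfl fun b hb => ?_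
    have ha := ne_of_mem_erase ha
    have hb := ne_of_mem_erase hb
    simp [hG', reattach, ha, hb, hzw]
  have n1 : ∑ w, z w ^ 2 = (σ / r) ^ 2 + ∑ w ∈ univ.erase v, x w ^ 2 := by
    rw [← add_sum_erase univ _ (mem_univ v), hzv]
    congr 1
    exact sum_congr rfl fun w hw => by rw [hzw w (ne_of_mem_erase hw)]
  have n2 : ∑ w, x w ^ 2 = x v ^ 2 + ∑ w ∈ univ.erase v, x w ^ 2 :=
    (add_sum_erase univ _ (mem_univ v)).symm
  have h := (specRad_spec G').1 z
  have h' : quadForm G' z ≤ r * ∑ w, z w ^ 2 :=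
    h.trans (mul_le_mul_of_nonneg_right hs (sum_nonneg fun w _ => sq_nonneg _))
  rw [quadForm] at h' q1
  rw [q3, e2, e3, n1] at h'
  rw [q2, e1, n2] at q1
  have h5 : σ ^ 2 / r ≤ r * x v ^ 2 := by
    have : r * (σ / r) ^ 2 = σ ^ 2 / r := by field_simp
    nlinarith
  rw [div_le_iff₀ hpos] at h5
  refine abs_le_of_sq_le_sq' ?_ (mul_nonneg hpos.le (hx v)) |>.2
  nlinarith

lemma hasEdgeDisjointTriangles_of_apex {W : Type*} {G : SimpleGraph W} {k : ℕ}
    {a b c : Fin k → W}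
    (hab : ∀ i, G.Adj (a i) (b i)) (hac : ∀ i, G.Adj (a i) (c i)) (hbc : ∀ i, G.Adj (b i) (c i))
    (hinj : Function.Injective fun i => s(a i, b i)) (hc : Function.Injective c)
    (hca : ∀ i j, c i ≠ a j) (hcb : ∀ i j, c i ≠ b j) : HasEdgeDisjointTriangles G k := by
  refine ⟨fun i => (a i, b i, c i), fun i => ⟨hab i, hbc i, hac i⟩, fun i j hij => ?_⟩
  have h1 : s(a i, b i) ≠ s(a j, b j) := fun h => hij (hinj h)
  have h2 : c i ≠ c j := fun h => hij (hc h)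
  have := hca i j
  have := hca j i
  have := hcb i j
  have := hcb j i
  rw [Set.disjoint_left]
  intro e he he'
  simp only [triEdges, Set.mem_insert_iff, Set.mem_singleton_iff] at he he'
  rcases he with rfl | rfl | rfl <;> rcases he' with he' | he' | he' <;>
    simp only [ne_eq, Sym2.eq_iff] at * <;> grind

/-- Distinct edges with many common neighbours yield edge-disjoint triangles. -/
lemma hasEdgeDisjointTriangles_of_common {G : SimpleGraph V} {k : ℕ} {a b : Fin k → V}
    (hab : ∀ i, G.Adj (a i) (b i)) (hinj : Function.Injective fun i => s(a i, b i))
    (hcard : ∀ i, 3 * k ≤ #{c | G.Adj (a i) c ∧ G.Adj (b i) c}) :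
    HasEdgeDisjointTriangles G k := by
  set S : Finset V := univ.image a ∪ univ.image b with hS
  have hScard : #S ≤ 2 * k := by
    have h1 : #(univ.image a) ≤ k := card_image_le.trans (by simp)
    have h2 : #(univ.image b) ≤ k := card_image_le.trans (by simp)
    have := card_union_le (univ.image a) (univ.image b)
    rw [hS]
    omega
  set t : Fin k → Finset V := fun i =>
    ({c | G.Adj (a i) c ∧ G.Adj (b i) c} : Finset V) \ S with ht
  have htk : ∀ i, k ≤ #(t i) := fun i => by
    have := le_card_sdiff S ({c | G.Adj (a i) c ∧ G.Adj (b i) c} : Finset V)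
    have := hcard i
    simp only [ht]
    omega
  obtain ⟨c, hc, hct⟩ := (all_card_le_biUnion_card_iff_exists_injective t).1 (fun s => by
    rcases s.eq_empty_or_nonempty with rfl | ⟨i, hi⟩
    · simp
    · have h1 : #s ≤ k := (card_le_univ s).trans (by simp)
      exact (h1.trans (htk i)).trans (card_le_card (subset_biUnion_of_mem t hi)))
  simp only [ht, mem_sdiff, mem_filter, mem_univ, true_and, hS, mem_union, mem_image,
    not_or, not_exists] at hct
  exact hasEdgeDisjointTriangles_of_apex hab (fun i => (hct i).1.1) (fun i => (hct i).1.2) hinj hc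
    (fun i j h => (hct i).2.1 j h.symm) (fun i j h => (hct i).2.2 j h.symm)

/-- Either a set contains a matching of size `j`, or at most `2 j` of its vertices cover all
of its edges. -/
lemma exists_matching_or_cover (G : SimpleGraph V) (N : Finset V) (j : ℕ) :
    (∃ a b : Fin j → V, (∀ i, a i ∈ N ∧ b i ∈ N ∧ G.Adj (a i) (b i)) ∧ Function.Injective a ∧
      Function.Injective b ∧ ∀ i i', a i ≠ b i') ∨
    ∃ K : Finset V, #K ≤ 2 * j ∧ ∀ v ∈ N \ K, ∀ w ∈ N \ K, ¬ G.Adj v w := by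
  induction j with
  | zero => exact Or.inl ⟨Fin.elim0, Fin.elim0, by simp, fun i => i.elim0, fun i => i.elim0,
      fun i => i.elim0⟩
  | succ j ih =>
    rcases ih with ⟨a, b, h, ha, hb, hab⟩ | ⟨K, hK, hind⟩
    swap
    · exact Or.inr ⟨K, by omega, hind⟩
    by_cases hcov : ∃ v ∈ N \ (univ.image a ∪ univ.image b),
        ∃ w ∈ N \ (univ.image a ∪ univ.image b), G.Adj v w
    · obtain ⟨v, hv, w, hw, hvw⟩ := hcov
      simp only [mem_sdiff, mem_union, mem_image, mem_univ, true_and, not_or, not_exists] at hv hw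
      refine Or.inl ⟨Fin.cons v a, Fin.cons w b, ?_, ?_, ?_, ?_⟩
      · intro i
        refine Fin.cases ⟨hv.1, hw.1, hvw⟩ (fun i => ?_) i
        simpa using h i
      · exact Fin.cons_injective_iff.2 ⟨by simpa using hv.2.1, ha⟩
      · exact Fin.cons_injective_iff.2 ⟨by simpa using hw.2.2, hb⟩
      · intro i i'
        refine Fin.cases ?_ (fun i => ?_) i <;> refine Fin.cases ?_ (fun i' => ?_) i'
        · simpa using hvw.ne
        · simpa using fun h => hv.2.2 i' h.symm
        · simpa using hw.2.1 i
        · simpa using hab i i'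
    · push Not at hcov
      refine Or.inr ⟨univ.image a ∪ univ.image b, ?_, hcov⟩
      have h1 : #(univ.image a) ≤ j := card_image_le.trans (by simp)
      have h2 : #(univ.image b) ≤ j := card_image_le.trans (by simp)
      have := card_union_le (univ.image a) (univ.image b)
      omega

/-- The neighbourhood of a vertex is nearly independent. -/
lemma exists_cover_neighbors {G : SimpleGraph V} {k : ℕ} (hG : ¬ HasEdgeDisjointTriangles G k)
    (u : V) : ∃ K : Finset V, #K ≤ 2 * k ∧
      ∀ v ∈ ({w | G.Adj u w} : Finset V) \ K, ∀ w ∈ ({w | G.Adj u w} : Finset V) \ K,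
        ¬ G.Adj v w := by
  rcases exists_matching_or_cover G {w | G.Adj u w} k with ⟨a, b, h, ha, hb, hab⟩ | h
  · simp only [mem_filter, mem_univ, true_and] at h
    refine absurd (hasEdgeDisjointTriangles_of_apex (a := fun _ => u) (b := a) (c := b)
      (fun i => (h i).1) (fun i => (h i).2.1) (fun i => (h i).2.2) ?_ hb
      (fun i _ => (h i).2.1.ne') fun i j => (hab j i).symm) hG
    intro i j hij
    simp only [Sym2.eq_iff] at hij
    exact ha (by grind)
  · exact h

/-- Making the neighbourhood of a vertex independent creates no triangles. -/
lemma not_hasEdgeDisjointTriangles_reattach {W : Type*} {G : SimpleGraph W} {k : ℕ}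
    (hG : ¬ HasEdgeDisjointTriangles G k) (v : W) {I : Finset W}
    (hI : ∀ a ∈ I, ∀ b ∈ I, ¬ G.Adj a b) : ¬ HasEdgeDisjointTriangles (reattach G v I) k := by
  rintro ⟨T, hT, hdisj⟩
  refine hG ⟨T, fun i => ?_, hdisj⟩
  obtain ⟨h1, h2, h3⟩ := hT i
  have := hI (T i).1
  have := hI (T i).2.1
  have := hI (T i).2.2
  simp only [reattach] at h1 h2 h3
  grind [G.adj_comm]

/-- In an extremal graph all entries of the eigenvector are almost maximal, and there is a large
independent set. -/
lemma exists_large_independent [Nonempty V] {G : SimpleGraph V} {k : ℕ}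
    (hG : ¬ HasEdgeDisjointTriangles G k)
    (hmax : ∀ G' : SimpleGraph V, ¬ HasEdgeDisjointTriangles G' k → specRad G' ≤ specRad G)
    (hpos : 2 * k + 1 < specRad G) :
    ∃ x : V → ℝ, (∀ v, 0 < x v) ∧ (∀ v, nbrSum G x v = specRad G * x v) ∧
      (∀ v, specRad G - 2 * k - 1 ≤ #{w | G.Adj v w}) ∧
      ∃ I : Finset V, (∀ a ∈ I, ∀ b ∈ I, ¬ G.Adj a b) ∧ specRad G - 2 * k - 1 ≤ #I := by
  obtain ⟨-, x, hx, hx0, heig⟩ := specRad_spec G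
  set r := specRad G with hr
  have hr0 : 0 < r := by
    have : (0 : ℝ) ≤ 2 * k + 1 := by positivity
    linarith
  obtain ⟨u, -, hu⟩ := exists_max_image univ x univ_nonempty
  have hup : 0 < x u := by
    obtain ⟨v, hv⟩ := Function.ne_iff.1 hx0
    have : x v ≠ 0 := hv
    exact lt_of_lt_of_le (lt_of_le_of_ne (hx v) this.symm) (hu v (mem_univ v))
  set N : Finset V := {w | G.Adj u w} with hN
  obtain ⟨K, hK, hind⟩ := exists_cover_neighbors hG u
  have hsumN : ∑ w ∈ N, x w = r * x u := by
    rw [← heig u, nbrSum, hN, sum_filter]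
  have hsub : ∀ s : Finset V, ∑ w ∈ s, x w ≤ #s * x u := fun s => by
    rw [← nsmul_eq_mul]
    exact sum_le_card_nsmul _ _ _ fun w _ => hu w (mem_univ w)
  have hKr : (#K : ℝ) ≤ 2 * k := by exact_mod_cast hK
  have hsumI : (r - 2 * k) * x u ≤ ∑ w ∈ N \ K, x w := by
    have h1 : ∑ w ∈ N, x w ≤ ∑ w ∈ N \ K, x w + ∑ w ∈ K, x w := by
      rw [← sum_union sdiff_disjoint]
      refine sum_le_sum_of_subset_of_nonneg (fun w hw => ?_) fun w _ _ => hx w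
      simp [hw]
    have h2 := hsub K
    have h3 := mul_le_mul_of_nonneg_right hKr hup.le
    nlinarith
  have hlarge : ∀ v, (r - 2 * k - 1) * x u ≤ r * x v := fun v => by
    have h1 := sum_le_of_specRad_reattach_le hx hr0 heig v (N \ K)
      (hmax _ (not_hasEdgeDisjointTriangles_reattach hG v hind))
    have h2 : ∑ w ∈ N \ K, x w ≤ ∑ w ∈ (N \ K).erase v, x w + x u := by
      by_cases hv : v ∈ N \ K
      · rw [← add_sum_erase _ _ hv]
        linarith [hu v (mem_univ v)]
      · rw [erase_eq_of_notMem hv]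
        linarith
    linarith
  refine ⟨x, fun v => ?_, heig, fun v => ?_, N \ K, hind, ?_⟩
  · have := hlarge v
    have h1 : 0 < (r - 2 * k - 1) * x u := mul_pos (by linarith) hup
    exact pos_of_mul_pos_right (h1.trans_le this) hr0.le
  · have h1 := hlarge v
    rw [← heig v, nbrSum, ← sum_filter] at h1
    exact le_of_mul_le_mul_right (h1.trans (hsub _)) hup
  · have h1 := hsumI.trans (hsub _)
    have := le_of_mul_le_mul_right h1 hup
    linarith

/-- The complete bipartite graph with parts `A` and its complement. -/
def crossGraph {W : Type*} (A : Finset W) : SimpleGraph W where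
  Adj u v := ¬ (u ∈ A ↔ v ∈ A)
  symm := ⟨fun _ _ h => by tauto⟩
  loopless := ⟨fun u h => h Iff.rfl⟩

/-- The edges of `G` inside the parts `A` and its complement. -/
def withinGraph {W : Type*} (G : SimpleGraph W) (A : Finset W) : SimpleGraph W where
  Adj u v := G.Adj u v ∧ (u ∈ A ↔ v ∈ A)
  symm := ⟨fun _ _ h => ⟨h.1.symm, h.2.symm⟩⟩
  loopless := ⟨fun u h => G.loopless.irrefl u h.1⟩

lemma withinGraph_adj {W : Type*} {G : SimpleGraph W} {A : Finset W} {u v : W} :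
    (withinGraph G A).Adj u v ↔ G.Adj u v ∧ (u ∈ A ↔ v ∈ A) := Iff.rfl

lemma crossGraph_compl (A : Finset V) : crossGraph Aᶜ = crossGraph A := by
  ext u v
  simp only [crossGraph, mem_compl]
  tauto

/-- A vertex with `k` neighbours in a nearly completely joined independent set has few
neighbours outside of it. -/
lemma card_outside_lt {G : SimpleGraph V} {k D : ℕ} (hG : ¬ HasEdgeDisjointTriangles G k)
    {I : Finset V} (hI : ∀ v ∈ I, #{w | w ∉ I ∧ ¬ G.Adj v w} ≤ D) {w : V}
    (hw : k ≤ #{v | v ∈ I ∧ G.Adj w v}) : #{v | v ∉ I ∧ G.Adj w v} < D + 3 * k := by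
  by_contra! hlarge
  obtain ⟨S, hS, hSk⟩ := exists_subset_card_eq hw
  let e := S.equivFinOfCardEq hSk
  have hb : ∀ i, ((e.symm i : V) ∈ I ∧ G.Adj w (e.symm i)) := fun i => by
    simpa using hS (e.symm i).2
  refine hG (hasEdgeDisjointTriangles_of_common (a := fun _ => w) (b := fun i => (e.symm i : V))
    (fun i => (hb i).2) ?_ fun i => ?_)
  · intro i j hij
    simp only [Sym2.eq_iff] at hij
    exact e.symm.injective (Subtype.ext (by grind))
  · have h1 : ({v | v ∉ I ∧ G.Adj w v} : Finset V) ⊆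
        ({c | G.Adj w c ∧ G.Adj (e.symm i : V) c} : Finset V) ∪
          ({c | c ∉ I ∧ ¬ G.Adj (e.symm i : V) c} : Finset V) := by
      intro c
      simp only [mem_filter, mem_univ, true_and, mem_union]
      tauto
    have h2 := (card_le_card h1).trans (card_union_le _ _)
    have h3 := hI _ (hb i).1
    omega

/-- A graph of large minimum degree with a large independent set and no `k` edge-disjoint triangles
is almost complete bipartite. -/
lemma exists_partition {G : SimpleGraph V} {k D n : ℕ} (hk : 1 ≤ k)
    (hG : ¬ HasEdgeDisjointTriangles G k) (hn : Fintype.card V = n) (hlarge : 4 * k + 5 * D < n)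
    (hdeg : ∀ v, n ≤ 2 * #{w | G.Adj v w} + D) {I : Finset V}
    (hI : ∀ a ∈ I, ∀ b ∈ I, ¬ G.Adj a b) (hIcard : n ≤ 2 * #I + D) :
    ∃ A : Finset V, A.Nonempty ∧ Aᶜ.Nonempty ∧
      ∀ v, #{w | (withinGraph G A).Adj v w} ≤ 2 * D + 3 * k := by
  have hmiss : ∀ v ∈ I, #{w | w ∉ I ∧ ¬ G.Adj v w} ≤ D := by
    intro v hv
    have h1 : Disjoint I ({w | w ∉ I ∧ ¬ G.Adj v w} : Finset V) := by
      rw [disjoint_left]; intro c hc; simp [hc]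
    have h2 : Disjoint (I ∪ ({w | w ∉ I ∧ ¬ G.Adj v w} : Finset V))
        ({w | G.Adj v w} : Finset V) := by
      rw [disjoint_left]
      intro c hc hc'
      simp only [mem_union, mem_filter, mem_univ, true_and] at hc hc'
      rcases hc with hc | hc
      · exact hI v hv c hc hc'
      · exact hc.2 hc'
    have h3 := card_le_univ
      ((I ∪ ({w | w ∉ I ∧ ¬ G.Adj v w} : Finset V)) ∪ ({w | G.Adj v w} : Finset V))
    rw [card_union_of_disjoint h2, card_union_of_disjoint h1, hn] at h3
    have := hdeg v
    omega
  set A : Finset V := {w | #{v | v ∈ I ∧ G.Adj w v} < k} with hA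
  have hIA : I ⊆ A := fun v hv => by
    have : ({w | w ∈ I ∧ G.Adj v w} : Finset V) = ∅ := by
      ext w; simpa using fun hw => hI v hv w hw
    simp only [hA, mem_filter, mem_univ, true_and, this, card_empty]
    omega
  have hAI : #(A \ I) ≤ 2 * D := by
    have hcount := sum_card_bipartiteAbove_eq_sum_card_bipartiteBelow (s := I) (t := A \ I)
      (fun v w => ¬ G.Adj v w)
    have h1 : ∑ v ∈ I, #(bipartiteAbove (fun v w => ¬ G.Adj v w) (A \ I) v) ≤ #I * D := by
      rw [← smul_eq_mul]
      refine sum_le_card_nsmul _ _ _ fun v hv => (card_le_card fun w hw => ?_).trans (hmiss v hv)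
      simp only [bipartiteAbove, mem_filter, mem_sdiff] at hw
      simp [hw.1.2, hw.2]
    have h2 : #(A \ I) * (#I - k) ≤
        ∑ w ∈ A \ I, #(bipartiteBelow (fun v w => ¬ G.Adj v w) I w) := by
      rw [← smul_eq_mul]
      refine card_nsmul_le_sum _ _ _ fun w hw => ?_
      have h3 : #{v | v ∈ I ∧ G.Adj w v} < k := by
        simpa [hA] using (mem_sdiff.1 hw).1
      have h4 : I ⊆ bipartiteBelow (fun v w => ¬ G.Adj v w) I w ∪
          ({v | v ∈ I ∧ G.Adj w v} : Finset V) := by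
        intro v hv
        simp only [bipartiteBelow, mem_union, mem_filter, mem_univ, true_and, hv,
          G.adj_comm w v]
        tauto
      have := (card_le_card h4).trans (card_union_le _ _)
      omega
    have h5 : #(A \ I) * (#I - k) ≤ #I * D := h2.trans (hcount ▸ h1)
    have h6 : #I ≤ 2 * (#I - k) := by omega
    have h7 : 0 < #I := by omega
    refine Nat.le_of_mul_le_mul_left (?_ : #I * _ ≤ #I * _) h7
    calc #I * #(A \ I) ≤ 2 * (#I - k) * #(A \ I) := Nat.mul_le_mul_right _ h6
      _ = 2 * (#(A \ I) * (#I - k)) := by ring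
      _ ≤ 2 * (#I * D) := Nat.mul_le_mul_left _ h5
      _ = #I * (2 * D) := by ring
  have hwithin : ∀ v, #{w | (withinGraph G A).Adj v w} ≤ 2 * D + 3 * k := by
    intro v
    by_cases hv : v ∈ A
    · have h1 : ({w | (withinGraph G A).Adj v w} : Finset V) ⊆
          ({w | w ∈ I ∧ G.Adj v w} : Finset V) ∪ (A \ I) := by
        intro w
        simp only [mem_filter, mem_univ, true_and, mem_union, mem_sdiff, withinGraph_adj]
        tauto
      have h2 := (card_le_card h1).trans (card_union_le _ _)
      have h3 : #{w | w ∈ I ∧ G.Adj v w} < k := by simpa [hA] using hv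
      omega
    · have h1 : ({w | (withinGraph G A).Adj v w} : Finset V) ⊆
          ({w | w ∉ I ∧ G.Adj v w} : Finset V) := by
        intro w
        have := @hIA w
        simp only [mem_filter, mem_univ, true_and, withinGraph_adj]
        tauto
      have h2 : k ≤ #{w | w ∈ I ∧ G.Adj v w} := by simpa [hA] using hv
      have := card_outside_lt hG hmiss h2
      have := card_le_card h1
      omega
  have hIne : I.Nonempty := card_pos.1 (by omega)
  refine ⟨A, hIne.mono hIA, ?_, hwithin⟩
  by_contra hempty
  rw [not_nonempty_iff_eq_empty, compl_eq_empty_iff] at hempty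
  obtain ⟨v, hv⟩ := hIne
  have h1 : #(({w | G.Adj v w} : Finset V)) ≤ #(A \ I) := card_le_card fun w hw => by
    have := hI v hv w
    simp only [mem_filter, mem_univ, true_and] at hw
    simp only [hempty, mem_sdiff, mem_univ, true_and]
    tauto
  have := hdeg v
  omega

/-- The parts of an almost complete bipartite graph are balanced, and vertices in the same part
have many common neighbours. -/
lemma balanced_of_within_le {G : SimpleGraph V} {n D C : ℕ} (hn : Fintype.card V = n)
    (hdeg : ∀ v, n ≤ 2 * #{w | G.Adj v w} + D) {A : Finset V} (hA : A.Nonempty)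
    (hA' : Aᶜ.Nonempty) (hwithin : ∀ v, #{w | (withinGraph G A).Adj v w} ≤ C) :
    n ≤ 2 * #A + (D + 2 * C) ∧ n ≤ 2 * #Aᶜ + (D + 2 * C) ∧
      ∀ a b, (a ∈ A ↔ b ∈ A) → n ≤ 2 * #{c | G.Adj a c ∧ G.Adj b c} + 3 * (D + 2 * C) := by
  have hcard : #A + #Aᶜ = n := by rw [card_add_card_compl, hn]
  have key : ∀ v, n ≤ 2 * #{w | G.Adj v w ∧ ¬ (v ∈ A ↔ w ∈ A)} + (D + 2 * C) := by
    intro v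
    have h1 : ({w | G.Adj v w} : Finset V) ⊆
        ({w | G.Adj v w ∧ ¬ (v ∈ A ↔ w ∈ A)} : Finset V) ∪
          ({w | (withinGraph G A).Adj v w} : Finset V) := by
      intro w
      simp only [mem_filter, mem_univ, true_and, mem_union, withinGraph_adj]
      tauto
    have h2 := (card_le_card h1).trans (card_union_le _ _)
    have := hwithin v
    have := hdeg v
    omega
  have hsub : ∀ v, #{w | G.Adj v w ∧ ¬ (v ∈ A ↔ w ∈ A)} ≤ if v ∈ A then #Aᶜ else #A := by
    intro v
    split_ifs with hv
    · refine card_le_card fun w => ?_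
      simp [hv]
    · refine card_le_card fun w => ?_
      simp [hv]
  have h1 : n ≤ 2 * #Aᶜ + (D + 2 * C) := by
    obtain ⟨v, hv⟩ := hA
    have := key v
    have := hsub v
    rw [if_pos hv] at this
    omega
  have h2 : n ≤ 2 * #A + (D + 2 * C) := by
    obtain ⟨v, hv⟩ := hA'
    have := key v
    have := hsub v
    rw [if_neg (by simpa using hv)] at this
    omega
  refine ⟨h2, h1, fun a b hab => ?_⟩
  have hunion : #(({w | G.Adj a w ∧ ¬ (a ∈ A ↔ w ∈ A)} : Finset V) ∪
      ({w | G.Adj b w ∧ ¬ (b ∈ A ↔ w ∈ A)} : Finset V)) ≤ if a ∈ A then #Aᶜ else #A := by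
    split_ifs with ha
    · refine card_le_card fun w => ?_
      have hb := hab.1 ha
      simp only [ha, hb, mem_union, mem_filter, mem_univ, true_and, true_iff, mem_compl]
      tauto
    · refine card_le_card fun w => ?_
      have hb : b ∉ A := fun h => ha (hab.2 h)
      simp only [ha, hb, mem_union, mem_filter, mem_univ, true_and, false_iff, not_not]
      tauto
  have hinter : #(({w | G.Adj a w ∧ ¬ (a ∈ A ↔ w ∈ A)} : Finset V) ∩
      ({w | G.Adj b w ∧ ¬ (b ∈ A ↔ w ∈ A)} : Finset V)) ≤ #{c | G.Adj a c ∧ G.Adj b c} := by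
    refine card_le_card fun w => ?_
    simp only [mem_inter, mem_filter, mem_univ, true_and]
    tauto
  have := card_union_add_card_inter ({w | G.Adj a w ∧ ¬ (a ∈ A ↔ w ∈ A)} : Finset V)
    ({w | G.Adj b w ∧ ¬ (b ∈ A ↔ w ∈ A)} : Finset V)
  have := key a
  have := key b
  split_ifs at hunion <;> omega

/-- A graph with at most `k - 1` edges inside the parts has no `k` edge-disjoint triangles. -/
lemma not_hasEdgeDisjointTriangles_of_within {G : SimpleGraph V} {A : Finset V} {k : ℕ}
    (h : #(withinGraph G A).edgeFinset < k) : ¬ HasEdgeDisjointTriangles G k := by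
  rintro ⟨T, hT, hdisj⟩
  have hex : ∀ i, ∃ e ∈ (withinGraph G A).edgeFinset, e ∈ triEdges (T i) := by
    intro i
    obtain ⟨h1, h2, h3⟩ := hT i
    by_cases h12 : (T i).1 ∈ A ↔ (T i).2.1 ∈ A
    · exact ⟨s((T i).1, (T i).2.1), SimpleGraph.mem_edgeFinset.2 ⟨h1, h12⟩, by simp [triEdges]⟩
    by_cases h23 : (T i).2.1 ∈ A ↔ (T i).2.2 ∈ A
    · exact ⟨s((T i).2.1, (T i).2.2), SimpleGraph.mem_edgeFinset.2 ⟨h2, h23⟩, by simp [triEdges]⟩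
    · exact ⟨s((T i).1, (T i).2.2),
        SimpleGraph.mem_edgeFinset.2 ⟨h3, by tauto⟩, by simp [triEdges]⟩
  choose e he he' using hex
  have hinj : Function.Injective e := fun i j hij => by
    by_contra hne
    exact Set.disjoint_left.1 (hdisj i j hne) (he' i) (hij ▸ he' j)
  have := card_le_card_of_injOn (s := univ) e (fun i _ => he i) hinj.injOn
  simp only [card_univ, Fintype.card_fin] at this
  omega

/-- If vertices in the same part have many common neighbours, there are few edges inside the
parts. -/
lemma card_within_lt {G : SimpleGraph V} {A : Finset V} {k : ℕ}
    (hG : ¬ HasEdgeDisjointTriangles G k)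
    (hcommon : ∀ a b, (a ∈ A ↔ b ∈ A) → 3 * k ≤ #{c | G.Adj a c ∧ G.Adj b c}) :
    #(withinGraph G A).edgeFinset < k := by
  by_contra! hle
  obtain ⟨S, hS, hSk⟩ := exists_subset_card_eq hle
  let f := S.equivFinOfCardEq hSk
  have hadj : ∀ i, (withinGraph G A).Adj (f.symm i : Sym2 V).out.1 (f.symm i : Sym2 V).out.2 := by
    intro i
    have := hS (f.symm i).2
    rw [SimpleGraph.mem_edgeFinset] at this
    rw [← SimpleGraph.mem_edgeSet]
    convert this
    exact Quot.out_eq _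
  refine hG (hasEdgeDisjointTriangles_of_common (fun i => (hadj i).1) ?_
    fun i => hcommon _ _ (hadj i).2)
  intro i j hij
  have : ∀ i, s((f.symm i : Sym2 V).out.1, (f.symm i : Sym2 V).out.2) = f.symm i :=
    fun i => Quot.out_eq _
  simp only [this] at hij
  exact f.symm.injective (Subtype.ext hij)

lemma card_edgeFinset_ge_of_adj (H : SimpleGraph V) {a b : V} (hab : H.Adj a b) :
    H.degree a + H.degree b ≤ #H.edgeFinset + 1 ∧
      (#H.edgeFinset + 1 ≤ H.degree a + H.degree b →
        ∀ c d, H.Adj c d → c = a ∨ c = b ∨ d = a ∨ d = b) := by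
  have hsub : H.incidenceFinset a ∪ H.incidenceFinset b ⊆ H.edgeFinset :=
    union_subset (H.incidenceFinset_subset a) (H.incidenceFinset_subset b)
  have hinter : H.incidenceFinset a ∩ H.incidenceFinset b = {s(a, b)} := by
    ext e
    have := Set.ext_iff.1 (H.incidenceSet_inter_incidenceSet_of_adj hab) e
    simpa using this
  have hcard := card_union_add_card_inter (H.incidenceFinset a) (H.incidenceFinset b)
  rw [hinter, card_singleton, H.card_incidenceFinset_eq_degree,
    H.card_incidenceFinset_eq_degree] at hcard
  have hle := card_le_card hsub
  refine ⟨by omega, fun hge c d hcd => ?_⟩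
  have heq := eq_of_subset_of_card_le hsub (by omega)
  have hmem : s(c, d) ∈ H.incidenceFinset a ∪ H.incidenceFinset b := by
    rw [heq]; simpa using hcd
  simp only [mem_union, SimpleGraph.mem_incidenceFinset, SimpleGraph.incidenceSet,
    Set.mem_ofPred_eq, Sym2.mem_iff] at hmem
  tauto

lemma sum_sum_adj_degree (H : SimpleGraph V) :
    (∑ v, ∑ w, if H.Adj v w then H.degree v + H.degree w else 0) = 2 * ∑ v, H.degree v ^ 2 := by
  have h1 : (∑ v, ∑ w, if H.Adj v w then H.degree v else 0) = ∑ v, H.degree v ^ 2 := by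
    refine sum_congr rfl fun v _ => ?_
    rw [← sum_filter, sum_const, ← SimpleGraph.neighborFinset_eq_filter, smul_eq_mul, sq,
      SimpleGraph.card_neighborFinset_eq_degree]
  have h2 : (∑ v, ∑ w, if H.Adj v w then H.degree w else 0) = ∑ v, H.degree v ^ 2 := by
    rw [← h1, sum_comm]
    exact sum_congr rfl fun v _ => sum_congr rfl fun w _ => by rw [H.adj_comm]
  rw [two_mul]
  nth_rewrite 1 [← h1]
  rw [← h2, ← sum_add_distrib]
  refine sum_congr rfl fun v _ => ?_
  rw [← sum_add_distrib]
  refine sum_congr rfl fun w _ => ?_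
  split_ifs <;> rfl

lemma sum_sum_adj_const (H : SimpleGraph V) (c : ℕ) :
    (∑ v, ∑ w, if H.Adj v w then c else 0) = 2 * #H.edgeFinset * c := by
  rw [← SimpleGraph.sum_degrees_eq_twice_card_edges, sum_mul]
  refine sum_congr rfl fun v _ => ?_
  rw [← sum_filter, sum_const, ← SimpleGraph.neighborFinset_eq_filter, smul_eq_mul,
    SimpleGraph.card_neighborFinset_eq_degree]

/-- The sum of the squares of the degrees of a graph with `m` edges is at most `m (m + 1)`. -/
lemma sum_degree_sq_le (H : SimpleGraph V) :
    ∑ v, H.degree v ^ 2 ≤ #H.edgeFinset * (#H.edgeFinset + 1) := by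
  have h1 : (∑ v, ∑ w, if H.Adj v w then H.degree v + H.degree w else 0) ≤
      ∑ v, ∑ w, if H.Adj v w then #H.edgeFinset + 1 else 0 := by
    refine sum_le_sum fun v _ => sum_le_sum fun w _ => ?_
    split_ifs with h
    · exact (card_edgeFinset_ge_of_adj H h).1
    · exact le_rfl
  rw [sum_sum_adj_degree, sum_sum_adj_const] at h1
  linarith

lemma intersecting_of_sum_degree_sq {H : SimpleGraph V}
    (h : ∑ v, H.degree v ^ 2 = #H.edgeFinset * (#H.edgeFinset + 1)) {a b c d : V}
    (hab : H.Adj a b) (hcd : H.Adj c d) : c = a ∨ c = b ∨ d = a ∨ d = b := by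
  refine (card_edgeFinset_ge_of_adj H hab).2 ?_ c d hcd
  by_contra! hlt
  have h1 : (∑ v, ∑ w, if H.Adj v w then H.degree v + H.degree w else 0) <
      ∑ v, ∑ w, if H.Adj v w then #H.edgeFinset + 1 else 0 := by
    have hle : ∀ v w, (if H.Adj v w then H.degree v + H.degree w else 0) ≤
        if H.Adj v w then #H.edgeFinset + 1 else 0 := by
      intro v w
      split_ifs with h
      · exact (card_edgeFinset_ge_of_adj H h).1
      · exact le_rfl
    refine sum_lt_sum (fun v _ => sum_le_sum fun w _ => hle v w) ⟨a, mem_univ a, ?_⟩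
    refine sum_lt_sum (fun w _ => hle a w) ⟨b, mem_univ b, ?_⟩
    simpa [hab] using hlt
  rw [sum_sum_adj_degree, sum_sum_adj_const, h] at h1
  linarith

/-- The star with center `c` and set of leaves `L`. -/
def starGraph {W : Type*} (c : W) (L : Finset W) : SimpleGraph W where
  Adj u v := u ≠ v ∧ ((u = c ∧ v ∈ L) ∨ (v = c ∧ u ∈ L))
  symm := ⟨fun _ _ h => ⟨h.1.symm, h.2.symm⟩⟩
  loopless := ⟨fun _ h => h.1 rfl⟩

/-- The complete graph on a set of vertices. -/
def cliqueGraph {W : Type*} (S : Finset W) : SimpleGraph W where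
  Adj u v := u ≠ v ∧ u ∈ S ∧ v ∈ S
  symm := ⟨fun _ _ h => ⟨h.1.symm, h.2.2, h.2.1⟩⟩
  loopless := ⟨fun _ h => h.1 rfl⟩

/-- A graph with pairwise intersecting edges is a star or a triangle. -/
lemma star_or_triangle {H : SimpleGraph V} {p q : V} (hpq : H.Adj p q)
    (hint : ∀ a b c d, H.Adj a b → H.Adj c d → c = a ∨ c = b ∨ d = a ∨ d = b) :
    (∃ c, H = starGraph c (H.neighborFinset c)) ∨ ∃ S : Finset V, #S = 3 ∧ H = cliqueGraph S := by
  have star : ∀ c, (∀ u v, H.Adj u v → u = c ∨ v = c) →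
      H = starGraph c (H.neighborFinset c) := by
    intro c hc
    ext u v
    simp only [starGraph, SimpleGraph.mem_neighborFinset]
    constructor
    · intro huv
      rcases hc u v huv with rfl | rfl
      · exact ⟨huv.ne, Or.inl ⟨rfl, huv⟩⟩
      · exact ⟨huv.ne, Or.inr ⟨rfl, huv.symm⟩⟩
    · rintro ⟨-, ⟨rfl, h⟩ | ⟨rfl, h⟩⟩
      · exact h
      · exact h.symm
  by_cases hp : ∀ u v, H.Adj u v → u = p ∨ v = p
  · exact Or.inl ⟨p, star p hp⟩
  by_cases hq : ∀ u v, H.Adj u v → u = q ∨ v = q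
  · exact Or.inl ⟨q, star q hq⟩
  push Not at hp hq
  have hp' : ∃ w, w ≠ p ∧ H.Adj q w := by
    obtain ⟨u, v, huv, hu, hv⟩ := hp
    rcases hint p q u v hpq huv with h | rfl | h | rfl
    · exact absurd h hu
    · exact ⟨v, hv, huv⟩
    · exact absurd h hv
    · exact ⟨u, hu, huv.symm⟩
  have hq' : ∃ w, w ≠ q ∧ H.Adj p w := by
    obtain ⟨u, v, huv, hu, hv⟩ := hq
    rcases hint p q u v hpq huv with rfl | h | rfl | h
    · exact ⟨v, hv, huv⟩
    · exact absurd h hu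
    · exact ⟨u, hu, huv.symm⟩
    · exact absurd h hv
  obtain ⟨w, hwp, hqw⟩ := hp'
  obtain ⟨w', hwq, hpw'⟩ := hq'
  have hw : w' = w := by
    have := hint q w p w' hqw hpw'
    have := hpq.ne
    tauto
  subst hw
  refine Or.inr ⟨{p, q, w'}, card_eq_three.2 ⟨p, q, w', hpq.ne, hwp.symm, hwq.symm, rfl⟩, ?_⟩
  ext u v
  simp only [cliqueGraph, mem_insert, mem_singleton]
  constructor
  · intro huv
    have := hint p q u v hpq huv
    have := hint q w' u v hqw huv
    have := hint p w' u v hpw' huv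
    have := huv.ne
    grind
  · rintro ⟨hne, rfl | rfl | rfl, rfl | rfl | rfl⟩ <;>
      first | exact absurd rfl hne | assumption | (apply SimpleGraph.Adj.symm; assumption)

lemma card_edgeFinset_starGraph_le (c : V) (L : Finset V) : #(starGraph c L).edgeFinset ≤ #L := by
  refine (card_le_card fun e he => ?_).trans (card_image_le (s := L) (f := fun l => s(c, l)))
  induction e with
  | _ u v =>
    rw [SimpleGraph.mem_edgeFinset, SimpleGraph.mem_edgeSet] at he
    rcases he.2 with ⟨rfl, h⟩ | ⟨rfl, h⟩
    · exact mem_image.2 ⟨v, h, rfl⟩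
    · exact mem_image.2 ⟨u, h, Sym2.eq_swap⟩

lemma crossGraph_adj {W : Type*} {A : Finset W} {u v : W} :
    (crossGraph A).Adj u v ↔ ¬(u ∈ A ↔ v ∈ A) := Iff.rfl

lemma withinGraph_sup {W : Type*} {A : Finset W} {H : SimpleGraph W}
    (hH : ∀ u v, H.Adj u v → (u ∈ A ↔ v ∈ A)) : withinGraph (crossGraph A ⊔ H) A = H := by
  ext u v
  have := hH u v
  simp only [withinGraph, crossGraph, SimpleGraph.sup_adj]
  tauto

lemma crossGraph_sup_withinGraph_ge {W : Type*} (G : SimpleGraph W) (A : Finset W) :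
    G ≤ crossGraph A ⊔ withinGraph G A := by
  intro u v huv
  simp only [withinGraph, crossGraph, SimpleGraph.sup_adj]
  tauto

lemma card_edgeFinset_crossGraph_sup {A : Finset V} {H : SimpleGraph V}
    (hH : ∀ u v, H.Adj u v → (u ∈ A ↔ v ∈ A)) :
    #(crossGraph A ⊔ H).edgeFinset = #A * #Aᶜ + #H.edgeFinset := by
  have hcross : (crossGraph A).edgeFinset = (A ×ˢ Aᶜ).image fun p => s(p.1, p.2) := by
    ext e
    induction e with
    | _ u v =>
      simp only [SimpleGraph.mem_edgeFinset, SimpleGraph.mem_edgeSet, crossGraph_adj, mem_image,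
        mem_product, mem_compl, Prod.exists, Sym2.eq_iff]
      constructor
      · intro h
        by_cases hu : u ∈ A
        · exact ⟨u, v, ⟨hu, by tauto⟩, Or.inl ⟨rfl, rfl⟩⟩
        · exact ⟨v, u, ⟨by tauto, hu⟩, Or.inr ⟨rfl, rfl⟩⟩
      · rintro ⟨a, b, ⟨ha, hb⟩, ⟨rfl, rfl⟩ | ⟨rfl, rfl⟩⟩ <;> tauto
  have hdisj : Disjoint (crossGraph A).edgeFinset H.edgeFinset := by
    rw [disjoint_left]
    intro e
    induction e with
    | _ u v =>
      simp only [SimpleGraph.mem_edgeFinset, SimpleGraph.mem_edgeSet]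
      exact fun h h' => h (hH u v h')
  have hunion : (crossGraph A ⊔ H).edgeFinset = (crossGraph A).edgeFinset ∪ H.edgeFinset := by
    ext e
    simp
  rw [hunion, card_union_of_disjoint hdisj, hcross, card_image_of_injOn, card_product]
  rintro ⟨a, b⟩ h ⟨a', b'⟩ h' heq
  simp only [coe_product, Set.mem_prod, mem_coe, mem_compl] at h h'
  simp only [Sym2.eq_iff] at heq
  grind

lemma exists_equiv_of_card_fiber {α β : Type*} [Fintype α] [Fintype β] (f : α → ℕ) (g : β → ℕ)
    (h : ∀ j, #{a | f a = j} = #{b | g b = j}) : ∃ e : α ≃ β, ∀ a, g (e a) = f a := by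
  have hcard : ∀ j, Fintype.card {a // f a = j} = Fintype.card {b // g b = j} := fun j => by
    rw [Fintype.card_subtype, Fintype.card_subtype]
    exact h j
  refine ⟨(Equiv.sigmaFiberEquiv f).symm.trans ((Equiv.sigmaCongrRight fun j =>
    Fintype.equivOfCardEq (hcard j)).trans (Equiv.sigmaFiberEquiv g)), fun a => ?_⟩
  exact (Fintype.equivOfCardEq (hcard (f a)) ⟨a, rfl⟩).2

lemma card_filter_fin (n lo hi : ℕ) (h : hi ≤ n) :
    #{i : Fin n | lo ≤ i.val ∧ i.val < hi} = hi - lo := by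
  rw [← Nat.card_Ico, ← card_map Fin.valEmbedding]
  congr 1
  ext j
  simp only [mem_map, mem_filter, mem_univ, true_and, Fin.valEmbedding_apply, mem_Ico]
  constructor
  · rintro ⟨i, hi, rfl⟩; exact hi
  · intro hj; exact ⟨⟨j, by omega⟩, hj, rfl⟩

lemma nonempty_iso_bipStar {A L : Finset V} {c : V} {n k : ℕ} (hn : Fintype.card V = n)
    (hk : 1 ≤ k) (hA : #A = n / 2) (hc : c ∈ A) (hcL : c ∉ L) (hL : L ⊆ A) (hLk : #L = k - 1) :
    Nonempty (crossGraph A ⊔ starGraph c L ≃g bipStar n k) := by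
  have hins : insert c L ⊆ A := insert_subset hc hL
  have hkn : k ≤ n / 2 := by
    have := card_le_card hins
    rw [card_insert_of_notMem hcL] at this
    omega
  let f : V → ℕ := fun v => if v = c then 0 else if v ∈ L then 1 else if v ∈ A then 2 else 3
  let g : Fin n → ℕ := fun i =>
    if i.val = 0 then 0 else if i.val < k then 1 else if i.val < n / 2 then 2 else 3
  obtain ⟨e, he⟩ := exists_equiv_of_card_fiber f g (fun j => by
    have hf : #{v | f v = j} = if j = 0 then 1 else if j = 1 then k - 1 else
        if j = 2 then n / 2 - k else if j = 3 then n - n / 2 else 0 := by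
      split_ifs with h0 h1 h2 h3
      · rw [← card_singleton c]; congr 1; ext v
        simp only [mem_filter, mem_univ, true_and, mem_singleton, f]; grind
      · rw [← hLk]; congr 1; ext v
        simp only [mem_filter, mem_univ, true_and, f]; grind
      · have : #(A \ insert c L) = n / 2 - k := by
          rw [card_sdiff_of_subset hins, card_insert_of_notMem hcL]; omega
        rw [← this]; congr 1; ext v
        simp only [mem_filter, mem_univ, true_and, mem_sdiff, mem_insert, f]; grind
      · rw [← hA, ← hn, ← card_compl]; congr 1; ext v
        simp only [mem_filter, mem_univ, true_and, mem_compl, f]; grind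
      · rw [card_eq_zero, filter_eq_empty_iff]
        intro v _
        simp only [f]; grind
    have hg : #{i | g i = j} = if j = 0 then 1 else if j = 1 then k - 1 else
        if j = 2 then n / 2 - k else if j = 3 then n - n / 2 else 0 := by
      split_ifs with h0 h1 h2 h3
      · refine Eq.trans ?_ (card_filter_fin n 0 1 (by omega)); congr 1; ext i
        simp only [mem_filter, mem_univ, true_and, g]; grind
      · rw [← card_filter_fin n 1 k (by omega)]; congr 1; ext i
        simp only [mem_filter, mem_univ, true_and, g]; grind
      · rw [← card_filter_fin n k (n / 2) (by omega)]; congr 1; ext i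
        simp only [mem_filter, mem_univ, true_and, g]; grind
      · rw [← card_filter_fin n (n / 2) n le_rfl]; congr 1; ext i
        simp only [mem_filter, mem_univ, true_and, g]; grind
      · rw [card_eq_zero, filter_eq_empty_iff]
        intro i _
        simp only [g]; grind
    rw [hf, hg])
  refine ⟨⟨e, fun {u v} => ?_⟩⟩
  have hne : e u = e v ↔ u = v := e.injective.eq_iff
  have key : ∀ w, ((e w).val = 0 ↔ w = c) ∧ (0 < (e w).val ∧ (e w).val < k ↔ w ∈ L) ∧
      ((e w).val < n / 2 ↔ w ∈ A) := by
    intro w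
    have hw := he w
    have h2 : w ∈ L → w ∈ A := fun h => hL h
    simp only [f, g] at hw
    clear he hins
    by_cases h : w = c
    · subst h; simp only [if_true] at hw; split_ifs at hw; grind
    · split_ifs at hw <;> grind
  obtain ⟨hu0, hu1, hu2⟩ := key u
  obtain ⟨hv0, hv1, hv2⟩ := key v
  simp only [bipStar, SimpleGraph.fromRel_adj, ne_eq, hne, SimpleGraph.sup_adj, crossGraph_adj,
    starGraph, hu0, hv0, hu1, hv1, ← not_lt, hu2, hv2]
  have huL : u ∈ L → u ∈ A := fun h => hL h
  have hvL : v ∈ L → v ∈ A := fun h => hL h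
  have huc : u = c → u ∈ A := fun h => h ▸ hc
  have hvc : v = c → v ∈ A := fun h => h ▸ hc
  have huv : u = v → (u ∈ A ↔ v ∈ A) := fun h => h ▸ Iff.rfl
  clear hu0 hu1 hu2 hv0 hv1 hv2 key hne he
  grind

lemma nonempty_iso_bipTri {A S : Finset V} {n : ℕ} (hn : Fintype.card V = n)
    (hA : #A = n / 2) (hS : S ⊆ A) (hS3 : #S = 3) :
    Nonempty (crossGraph A ⊔ cliqueGraph S ≃g bipTri n) := by
  have hkn : 3 ≤ n / 2 := by
    have := card_le_card hS
    omega
  let f : V → ℕ := fun v => if v ∈ S then 1 else if v ∈ A then 2 else 3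
  let g : Fin n → ℕ := fun i => if i.val < 3 then 1 else if i.val < n / 2 then 2 else 3
  obtain ⟨e, he⟩ := exists_equiv_of_card_fiber f g (fun j => by
    have hf : #{v | f v = j} = if j = 1 then 3 else
        if j = 2 then n / 2 - 3 else if j = 3 then n - n / 2 else 0 := by
      split_ifs with h1 h2 h3
      · rw [← hS3]; congr 1; ext v
        simp only [mem_filter, mem_univ, true_and, f]; grind
      · have : #(A \ S) = n / 2 - 3 := by
          rw [card_sdiff_of_subset hS]; omega
        rw [← this]; congr 1; ext v
        simp only [mem_filter, mem_univ, true_and, mem_sdiff, f]; grind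
      · rw [← hA, ← hn, ← card_compl]; congr 1; ext v
        simp only [mem_filter, mem_univ, true_and, mem_compl, f]; grind
      · rw [card_eq_zero, filter_eq_empty_iff]
        intro v _
        simp only [f]; grind
    have hg : #{i | g i = j} = if j = 1 then 3 else
        if j = 2 then n / 2 - 3 else if j = 3 then n - n / 2 else 0 := by
      split_ifs with h1 h2 h3
      · refine Eq.trans ?_ (card_filter_fin n 0 3 (by omega)); congr 1; ext i
        simp only [mem_filter, mem_univ, true_and, g]; grind
      · rw [← card_filter_fin n 3 (n / 2) (by omega)]; congr 1; ext i
        simp only [mem_filter, mem_univ, true_and, g]; grind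
      · rw [← card_filter_fin n (n / 2) n le_rfl]; congr 1; ext i
        simp only [mem_filter, mem_univ, true_and, g]; grind
      · rw [card_eq_zero, filter_eq_empty_iff]
        intro i _
        simp only [g]; grind
    rw [hf, hg])
  refine ⟨⟨e, fun {u v} => ?_⟩⟩
  have hu := he u
  have hv := he v
  have hne : e u = e v ↔ u = v := e.injective.eq_iff
  have h2 : ∀ w, w ∈ S → w ∈ A := fun w h => hS h
  simp only [bipTri, SimpleGraph.fromRel_adj, ne_eq, hne, SimpleGraph.sup_adj, crossGraph,
    cliqueGraph]
  simp only [f, g] at hu hv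
  clear he
  grind

lemma nbrSum_crossGraph_sup {A : Finset V} {H : SimpleGraph V}
    (hH : ∀ u v, H.Adj u v → (u ∈ A ↔ v ∈ A)) (x : V → ℝ) {v : V} (hv : v ∈ A) :
    nbrSum (crossGraph A ⊔ H) x v = ∑ w ∈ Aᶜ, x w + nbrSum H x v := by
  have h1 : ∑ w ∈ Aᶜ, x w = ∑ w, if w ∈ Aᶜ then x w else 0 := by
    rw [sum_ite_mem, univ_inter]
  rw [h1, nbrSum, nbrSum, ← sum_add_distrib]
  refine sum_congr rfl fun w _ => ?_
  have := hH v w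
  simp only [SimpleGraph.sup_adj, crossGraph_adj, hv, true_iff, mem_compl] at this ⊢
  by_cases hw : w ∈ A <;> by_cases hvw : H.Adj v w <;> simp_all

lemma nbrSum_crossGraph_sup_compl {A : Finset V} {H : SimpleGraph V}
    (hH : ∀ u v, H.Adj u v → (u ∈ A ↔ v ∈ A)) (x : V → ℝ) {v : V} (hv : v ∉ A) :
    nbrSum (crossGraph A ⊔ H) x v = ∑ w ∈ A, x w + nbrSum H x v := by
  have h := nbrSum_crossGraph_sup (A := Aᶜ) (H := H)
    (fun u v huv => by simpa [mem_compl, not_iff_not] using hH u v huv) x (mem_compl.2 hv)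
  rwa [crossGraph_compl, compl_compl] at h

lemma nbrSum_eq_zero {H : SimpleGraph V} (x : V → ℝ) {v : V} (hv : ∀ w, ¬ H.Adj v w) :
    nbrSum H x v = 0 :=
  sum_eq_zero fun w _ => if_neg (hv w)

lemma nbrSum_nonneg {H : SimpleGraph V} {x : V → ℝ} (hx : ∀ v, 0 ≤ x v) (v : V) :
    0 ≤ nbrSum H x v :=
  sum_nonneg fun w _ => by split_ifs <;> [exact hx w; exact le_rfl]

/-- Weight of the two sides in an eigenvector of a complete bipartite graph together with a
graph embedded in one side. -/
lemma mul_sum_le_of_eigenvector {A : Finset V} {H : SimpleGraph V} {x : V → ℝ} {r S : ℝ} {m : ℕ}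
    (hH : ∀ u v, H.Adj u v → (u ∈ A ↔ v ∈ A)) (hx : ∀ v, 0 < x v) (hA : A.Nonempty)
    (hm : #H.edgeFinset ≤ m) (hr : (m : ℝ) < r)
    (heig : ∀ v ∈ A, r * x v = S + nbrSum H x v) :
    r * (r * ∑ v ∈ A, x v) ≤
      S * (#A * r + ((∑ v ∈ A, H.degree v : ℕ) : ℝ) +
        ((∑ v ∈ A, H.degree v ^ 2 : ℕ) : ℝ) / (r - m)) := by
  obtain ⟨v₀, hv₀, hmax⟩ := exists_max_image A x hA
  have hdeg : ∀ v, (H.degree v : ℝ) ≤ m := fun v => by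
    have : H.degree v ≤ #H.edgeFinset := by
      rw [← H.card_incidenceFinset_eq_degree]
      exact card_le_card (H.incidenceFinset_subset v)
    exact_mod_cast this.trans hm
  have hnbr : ∀ v ∈ A, nbrSum H x v ≤ H.degree v * x v₀ := by
    intro v hv
    rw [nbrSum, ← sum_filter, ← SimpleGraph.neighborFinset_eq_filter,
      ← SimpleGraph.card_neighborFinset_eq_degree, ← nsmul_eq_mul]
    refine sum_le_card_nsmul _ _ _ fun w hw => hmax w ?_
    exact (hH v w ((H.mem_neighborFinset v w).1 hw)).1 hv
  have hM : x v₀ ≤ S / (r - m) := by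
    rw [le_div_iff₀ (by linarith)]
    have h1 := heig v₀ hv₀
    have h2 := hnbr v₀ hv₀
    have h3 := mul_le_mul_of_nonneg_right (hdeg v₀) (hx v₀).le
    linarith
  have hswap : ∑ v ∈ A, nbrSum H x v = ∑ v ∈ A, H.degree v * x v := by
    have h1 : ∀ v ∈ A, nbrSum H x v = ∑ w ∈ A, if H.Adj v w then x w else 0 := by
      intro v hv
      rw [nbrSum]
      refine (sum_subset (subset_univ A) fun w _ hw => if_neg fun h => hw ?_).symm
      exact (hH v w h).1 hv
    rw [sum_congr rfl h1, sum_comm]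
    refine sum_congr rfl fun w hw => ?_
    rw [← SimpleGraph.card_neighborFinset_eq_degree, ← nsmul_eq_mul, ← sum_const,
      SimpleGraph.neighborFinset_eq_filter, sum_filter]
    simp only [H.adj_comm w]
    refine sum_subset (subset_univ A) fun v _ hv => if_neg fun h => hv ?_
    exact (hH v w h).2 hw
  have hS : r * ∑ v ∈ A, x v = #A * S + ∑ v ∈ A, H.degree v * x v := by
    rw [mul_sum, sum_congr rfl heig, sum_add_distrib, sum_const, nsmul_eq_mul, hswap]
  have hT : r * ∑ v ∈ A, H.degree v * x v ≤
      ((∑ v ∈ A, H.degree v : ℕ) : ℝ) * S +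
        ((∑ v ∈ A, H.degree v ^ 2 : ℕ) : ℝ) * (S / (r - m)) := by
    push_cast
    rw [mul_sum, sum_mul, sum_mul, ← sum_add_distrib]
    refine sum_le_sum fun v hv => ?_
    have h1 := (hnbr v hv).trans (mul_le_mul_of_nonneg_left hM (Nat.cast_nonneg _))
    have h2 := mul_le_mul_of_nonneg_left h1 (Nat.cast_nonneg (α := ℝ) (H.degree v))
    have h3 := heig v hv
    calc r * (H.degree v * x v) = H.degree v * (r * x v) := by ring
      _ = H.degree v * S + H.degree v * nbrSum H x v := by rw [h3]; ring
      _ ≤ _ := by linarith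
  rw [hS, mul_add]
  calc r * (#A * S) + r * ∑ v ∈ A, H.degree v * x v ≤ _ := add_le_add_right hT _
    _ = _ := by ring

/-- An upper bound for the spectral radius of a complete bipartite graph with few
additional edges inside the parts. -/
lemma pow_four_le_of_le_specRad {A : Finset V} {H : SimpleGraph V} {x : V → ℝ} {r s : ℝ} {m : ℕ}
    (hH : ∀ u v, H.Adj u v → (u ∈ A ↔ v ∈ A)) (hx : ∀ v, 0 < x v) (hA : A.Nonempty)
    (hA' : Aᶜ.Nonempty) (hm : #H.edgeFinset ≤ m) (hr : (m : ℝ) < r) (hrs : r ≤ s)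
    (heig : ∀ v, nbrSum (crossGraph A ⊔ H) x v = s * x v) :
    r ^ 4 ≤ (#A * r + ((∑ v ∈ A, H.degree v : ℕ) : ℝ) +
        ((∑ v ∈ A, H.degree v ^ 2 : ℕ) : ℝ) / (r - m)) *
      (#Aᶜ * r + ((∑ v ∈ Aᶜ, H.degree v : ℕ) : ℝ) +
        ((∑ v ∈ Aᶜ, H.degree v ^ 2 : ℕ) : ℝ) / (r - m)) := by
  have hm0 : (0 : ℝ) ≤ m := Nat.cast_nonneg m
  have hr0 : 0 < r := by linarith
  have hs0 : 0 < s := by linarith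
  have h1 := mul_sum_le_of_eigenvector (S := ∑ w ∈ Aᶜ, x w) hH hx hA hm (hr.trans_le hrs)
    fun v hv => by rw [← heig, nbrSum_crossGraph_sup hH x hv]
  have h2 := mul_sum_le_of_eigenvector (A := Aᶜ) (S := ∑ w ∈ A, x w)
    (fun u v huv => by simpa [mem_compl, not_iff_not] using hH u v huv) hx hA' hm
    (hr.trans_le hrs)
    fun v hv => by rw [← heig, nbrSum_crossGraph_sup_compl hH x (mem_compl.1 hv)]
  have hSA : 0 < ∑ w ∈ A, x w := sum_pos (fun v _ => hx v) hA
  have hSB : 0 < ∑ w ∈ Aᶜ, x w := sum_pos (fun v _ => hx v) hA'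
  have mono : ∀ a p w : ℕ, (a * s + p + w / (s - m) : ℝ) / s ≤ (a * r + p + w / (r - m)) / r := by
    intro a p w
    have e1 : (a * s + p + w / (s - m) : ℝ) / s = a + p / s + w / (s - m) / s := by
      field_simp
    have e2 : (a * r + p + w / (r - m) : ℝ) / r = a + p / r + w / (r - m) / r := by
      field_simp
    rw [e1, e2]
    have : 0 < r - m := by linarith
    gcongr
  set SA := ∑ w ∈ A, x w
  set SB := ∑ w ∈ Aᶜ, x w
  have mA := mono #A (∑ v ∈ A, H.degree v) (∑ v ∈ A, H.degree v ^ 2)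
  have mB := mono #Aᶜ (∑ v ∈ Aᶜ, H.degree v) (∑ v ∈ Aᶜ, H.degree v ^ 2)
  set fA := (#A * s + ((∑ v ∈ A, H.degree v : ℕ) : ℝ) +
        ((∑ v ∈ A, H.degree v ^ 2 : ℕ) : ℝ) / (s - m))
  set fB := (#Aᶜ * s + ((∑ v ∈ Aᶜ, H.degree v : ℕ) : ℝ) +
        ((∑ v ∈ Aᶜ, H.degree v ^ 2 : ℕ) : ℝ) / (s - m))
  set gA := (#A * r + ((∑ v ∈ A, H.degree v : ℕ) : ℝ) +
        ((∑ v ∈ A, H.degree v ^ 2 : ℕ) : ℝ) / (r - m))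
  set gB := (#Aᶜ * r + ((∑ v ∈ Aᶜ, H.degree v : ℕ) : ℝ) +
        ((∑ v ∈ Aᶜ, H.degree v ^ 2 : ℕ) : ℝ) / (r - m))
  have k1 : s * SA ≤ SB * (gA / r) := by
    have : s * SA ≤ SB * (fA / s) := by
      rw [mul_div_assoc', le_div_iff₀ hs0]; linarith
    exact this.trans (mul_le_mul_of_nonneg_left mA hSB.le)
  have k2 : s * SB ≤ SA * (gB / r) := by
    have : s * SB ≤ SA * (fB / s) := by
      rw [mul_div_assoc', le_div_iff₀ hs0]; linarith
    exact this.trans (mul_le_mul_of_nonneg_left mB hSA.le)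
  have k3 := mul_le_mul k1 k2 (by positivity) ((by positivity : 0 ≤ s * SA).trans k1)
  have k4 : s ^ 2 ≤ gA * gB / r ^ 2 := by
    refine le_of_mul_le_mul_right ?_ (mul_pos hSA hSB)
    calc s ^ 2 * (SA * SB) = s * SA * (s * SB) := by ring
      _ ≤ _ := k3
      _ = _ := by ring
  have k5 : r ^ 2 ≤ s ^ 2 := pow_le_pow_left₀ hr0.le hrs 2
  have k6 := k5.trans k4
  rw [le_div_iff₀ (by positivity)] at k6
  linarith

/-- Eigenvector equations for a complete bipartite graph with a graph embedded in one part. -/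
lemma exists_eigenvector_crossGraph_sup {A : Finset V} {H : SimpleGraph V}
    (hH : ∀ u v, H.Adj u v → u ∈ A) (hA : A.Nonempty) (hA' : Aᶜ.Nonempty) :
    ∃ (x : V → ℝ) (S : ℝ), (∀ v, 0 ≤ x v) ∧ 0 < S ∧ 0 < specRad (crossGraph A ⊔ H) ∧
      (∀ v ∈ A, specRad (crossGraph A ⊔ H) * x v = S + nbrSum H x v) ∧
      specRad (crossGraph A ⊔ H) ^ 2 * S = #Aᶜ * (#A * S + ∑ v ∈ A, nbrSum H x v) := by
  have hH' : ∀ u v, H.Adj u v → (u ∈ A ↔ v ∈ A) := fun u v huv =>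
    iff_of_true (hH u v huv) (hH v u huv.symm)
  have : Nonempty V := ⟨hA'.choose⟩
  obtain ⟨-, x, hx, hx0, heig⟩ := specRad_spec (crossGraph A ⊔ H)
  set r := specRad (crossGraph A ⊔ H)
  have h1 : ∀ v ∈ A, r * x v = ∑ w ∈ Aᶜ, x w + nbrSum H x v := fun v hv => by
    rw [← heig, nbrSum_crossGraph_sup hH' x hv]
  have h2 : ∀ v ∉ A, r * x v = ∑ w ∈ A, x w := fun v hv => by
    rw [← heig, nbrSum_crossGraph_sup_compl hH' x hv,
      nbrSum_eq_zero x fun w hw => hv (hH v w hw), add_zero]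
  have h3 : r * ∑ w ∈ Aᶜ, x w = #Aᶜ * ∑ w ∈ A, x w := by
    rw [mul_sum, sum_congr rfl fun v hv => h2 v (mem_compl.1 hv), sum_const, nsmul_eq_mul]
  have h4 : r * ∑ w ∈ A, x w = #A * ∑ w ∈ Aᶜ, x w + ∑ v ∈ A, nbrSum H x v := by
    rw [mul_sum, sum_congr rfl h1, sum_add_distrib, sum_const, nsmul_eq_mul]
  have hSB : 0 ≤ ∑ w ∈ Aᶜ, x w := sum_nonneg fun v _ => hx v
  have hb : (0 : ℝ) < #Aᶜ := by exact_mod_cast hA'.card_pos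
  have hT : 0 ≤ ∑ v ∈ A, nbrSum H x v := sum_nonneg fun v _ => nbrSum_nonneg hx v
  have hSA0 : 0 ≤ ∑ w ∈ A, x w := sum_nonneg fun v _ => hx v
  have hSA : 0 < ∑ w ∈ A, x w := by
    refine hSA0.lt_of_ne fun h0 => hx0 ?_
    have hzero : ∀ v ∈ A, x v = 0 := (sum_eq_zero_iff_of_nonneg fun v _ => hx v).1 h0.symm
    obtain ⟨v, hv⟩ := hA
    have h5 := h1 v hv
    rw [hzero v hv, mul_zero] at h5
    have h6 : ∑ w ∈ Aᶜ, x w = 0 := by linarith [nbrSum_nonneg (H := H) hx v]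
    have hzero' := (sum_eq_zero_iff_of_nonneg fun v _ => hx v).1 h6
    funext w
    by_cases hw : w ∈ A
    · exact hzero w hw
    · exact hzero' w (mem_compl.2 hw)
  have hpos : 0 < r * ∑ w ∈ Aᶜ, x w := h3 ▸ mul_pos hb hSA
  have hSBpos : 0 < ∑ w ∈ Aᶜ, x w := hSB.lt_of_ne fun h => by simp [← h] at hpos
  have hr : 0 < r := pos_of_mul_pos_left hpos hSB
  refine ⟨x, ∑ w ∈ Aᶜ, x w, hx, hSBpos, hr, h1, ?_⟩
  calc r ^ 2 * ∑ w ∈ Aᶜ, x w = r * (r * ∑ w ∈ Aᶜ, x w) := by ring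
    _ = #Aᶜ * (r * ∑ w ∈ A, x w) := by rw [h3]; ring
    _ = _ := by rw [h4]

lemma specRad_star {A L : Finset V} {c : V} (hc : c ∈ A) (hcL : c ∉ L) (hL : L ⊆ A)
    (hA' : Aᶜ.Nonempty) {r : ℝ} (hr : r = specRad (crossGraph A ⊔ starGraph c L)) :
    0 < r ∧ (#A * #Aᶜ : ℝ) ≤ r ^ 2 ∧
      (r ^ 2 - #A * #Aᶜ) * (r ^ 2 - #L) = #Aᶜ * (2 * #L * r + #L * (#L + 1)) := by
  have hH : ∀ u v, (starGraph c L).Adj u v → u ∈ A := by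
    rintro u v ⟨-, ⟨rfl, -⟩ | ⟨-, h⟩⟩
    exacts [hc, hL h]
  obtain ⟨x, S, hx, hS, hr0, h1, h2⟩ := exists_eigenvector_crossGraph_sup hH ⟨c, hc⟩ hA'
  rw [← hr] at hr0 h1 h2
  have hnbr : ∀ v, nbrSum (starGraph c L) x v =
      (if v = c then ∑ w ∈ L, x w else 0) + if v ∈ L then x c else 0 := by
    intro v
    by_cases hv : v = c
    · subst hv
      rw [if_pos rfl, if_neg hcL, add_zero, nbrSum, ← sum_filter]
      congr 1
      ext w
      simp only [mem_filter, mem_univ, true_and, starGraph]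
      grind
    · rw [if_neg hv, zero_add]
      split_ifs with hvL
      · rw [nbrSum, sum_eq_single c]
        · exact if_pos ⟨hv, Or.inr ⟨rfl, hvL⟩⟩
        · intro w _ hw
          refine if_neg ?_
          rintro ⟨-, ⟨h, -⟩ | ⟨h, -⟩⟩ <;> contradiction
        · exact fun h => absurd (mem_univ c) h
      · refine nbrSum_eq_zero x fun w => ?_
        rintro ⟨-, ⟨h, -⟩ | ⟨-, h⟩⟩ <;> contradiction
  set y := ∑ w ∈ L, x w with hy
  have hT : ∑ v ∈ A, nbrSum (starGraph c L) x v = y + #L * x c := by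
    rw [sum_congr rfl fun v _ => hnbr v, sum_add_distrib, sum_ite_eq', if_pos hc, sum_ite_mem,
      inter_eq_right.2 hL, sum_const, nsmul_eq_mul]
  have hxc : r * x c = S + y := by
    rw [h1 c hc, hnbr, if_pos rfl, if_neg hcL, add_zero]
  have hleaf : ∀ v ∈ L, nbrSum (starGraph c L) x v = x c := fun v hv => by
    have hvc : v ≠ c := fun h => hcL (h ▸ hv)
    rw [hnbr, if_neg hvc, if_pos hv, zero_add]
  have hry : r * y = #L * S + #L * x c := by
    rw [hy, mul_sum, sum_congr rfl fun v hv => h1 v (hL hv), sum_add_distrib, sum_const,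
      nsmul_eq_mul, sum_congr rfl hleaf, sum_const, nsmul_eq_mul]
  rw [hT] at h2
  have hy0 : 0 ≤ y := sum_nonneg fun v _ => hx v
  have hxc0 := hx c
  refine ⟨hr0, ?_, ?_⟩
  · refine le_of_mul_le_mul_right ?_ hS
    rw [h2]
    have : (0 : ℝ) ≤ #Aᶜ * (y + #L * x c) := by positivity
    linarith
  · refine mul_right_cancel₀ hS.ne' ?_
    set l : ℝ := (#L : ℝ)
    have hT2 : (y + l * x c) * (r ^ 2 - l) = (2 * l * r + l * (l + 1)) * S := by
      linear_combination (l * r + l) * hxc + (r + l) * hry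
    linear_combination (r ^ 2 - l) * h2 + (#Aᶜ : ℝ) * hT2

lemma specRad_clique {A T : Finset V} (hT : T ⊆ A) (hA : A.Nonempty)
    (hA' : Aᶜ.Nonempty) {r : ℝ} (hr : r = specRad (crossGraph A ⊔ cliqueGraph T)) :
    0 < r ∧ (#A * #Aᶜ : ℝ) ≤ r ^ 2 ∧
      (r ^ 2 - #A * #Aᶜ) * (r - (#T - 1)) = #Aᶜ * (#T * (#T - 1)) := by
  have hH : ∀ u v, (cliqueGraph T).Adj u v → u ∈ A := fun u v h => hT h.2.1
  obtain ⟨x, S, hx, hS, hr0, h1, h2⟩ := exists_eigenvector_crossGraph_sup hH hA hA'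
  rw [← hr] at hr0 h1 h2
  have hnbr : ∀ v, nbrSum (cliqueGraph T) x v = if v ∈ T then ∑ w ∈ T, x w - x v else 0 := by
    intro v
    split_ifs with hv
    · rw [nbrSum, ← sum_filter, eq_sub_iff_add_eq, ← sum_erase_add T x hv]
      refine congrArg (· + x v) (sum_congr ?_ fun _ _ => rfl)
      ext w
      simp only [cliqueGraph, mem_erase]
      grind
    · exact nbrSum_eq_zero x fun w h => hv h.2.1
  set y := ∑ w ∈ T, x w with hy
  have hsum : ∑ v ∈ T, (y - x v) = (#T - 1) * y := by
    rw [sum_sub_distrib, sum_const, nsmul_eq_mul, ← hy]; ring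
  have hTsum : ∑ v ∈ A, nbrSum (cliqueGraph T) x v = (#T - 1) * y := by
    rw [sum_congr rfl fun v _ => hnbr v, sum_ite_mem, inter_eq_right.2 hT, hsum]
  have hry : r * y = #T * S + (#T - 1) * y := by
    nth_rewrite 1 [hy]
    rw [mul_sum, sum_congr rfl fun v hv => h1 v (hT hv), sum_add_distrib, sum_const,
      nsmul_eq_mul, sum_congr rfl fun v hv => (hnbr v).trans (if_pos hv), hsum]
  have hT0 : 0 ≤ ∑ v ∈ A, nbrSum (cliqueGraph T) x v := sum_nonneg fun v _ => nbrSum_nonneg hx v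
  rw [hTsum] at h2 hT0
  refine ⟨hr0, ?_, ?_⟩
  · refine le_of_mul_le_mul_right ?_ hS
    rw [h2]
    have : (0 : ℝ) ≤ #Aᶜ * ((#T - 1) * y) := by positivity
    linarith
  · refine mul_right_cancel₀ hS.ne' ?_
    set l : ℝ := (#T : ℝ)
    linear_combination (r - (l - 1)) * h2 + (#Aᶜ : ℝ) * (l - 1) * hry

/-- A star with three edges gives a smaller spectral radius than a triangle. -/
lemma specRad_star_lt_specRad_clique {A L T : Finset V} {c : V} (hc : c ∈ A) (hcL : c ∉ L)
    (hL : L ⊆ A) (hL3 : #L = 3) (hT : T ⊆ A) (hT3 : #T = 3) (hA' : Aᶜ.Nonempty)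
    (h2 : 2 < specRad (crossGraph A ⊔ starGraph c L)) :
    specRad (crossGraph A ⊔ starGraph c L) < specRad (crossGraph A ⊔ cliqueGraph T) := by
  by_contra! hle
  obtain ⟨-, hs1, hs2⟩ := specRad_star hc hcL hL hA' rfl
  obtain ⟨hr0, hr1, hr2⟩ := specRad_clique hT ⟨c, hc⟩ hA' rfl
  set s := specRad (crossGraph A ⊔ starGraph c L)
  set r := specRad (crossGraph A ⊔ cliqueGraph T)
  rw [hL3] at hs2
  rw [hT3] at hr2
  have hb : (0 : ℝ) < #Aᶜ := by exact_mod_cast hA'.card_pos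
  push_cast at hs2 hr2
  set P : ℝ := #A * #Aᶜ
  have hr2' : (r ^ 2 - P) * (r - 2) = 6 * #Aᶜ := by linarith
  have hsq : r ^ 2 ≤ s ^ 2 := pow_le_pow_left₀ hr0.le hle 2
  have k1 : (r ^ 2 - P) * (r - 2) ≤ (s ^ 2 - P) * (s - 2) := by
    calc (r ^ 2 - P) * (r - 2) ≤ (r ^ 2 - P) * (s - 2) :=
          mul_le_mul_of_nonneg_left (by linarith) (by linarith)
      _ ≤ _ := mul_le_mul_of_nonneg_right (by linarith) (by linarith)
  have k2 : (s ^ 2 - P) * (s - 2) * (s ^ 2 - 3) = #Aᶜ * (6 * s ^ 2 - 24) := by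
    linear_combination (s - 2) * hs2
  have k3 := mul_le_mul_of_nonneg_right (hr2' ▸ k1) (by nlinarith : 0 ≤ s ^ 2 - 3)
  nlinarith

lemma mul_le_of_small_corrections {a b m W pA pB wA wB r : ℝ} (habR : a ≤ b)
    (hm0 : 0 ≤ m) (hpA0 : 0 ≤ pA) (hpB0 : 0 ≤ pB) (hwA0 : 0 ≤ wA) (hwB0 : 0 ≤ wB)
    (hrm : 1 ≤ r - m) (hbr : b ≤ 6 * (r - m)) (hpm : pA + pB ≤ 2 * m) (hwW : wA + wB ≤ W) :
    (a * r + pA + wA / (r - m)) * (b * r + pB + wB / (r - m)) ≤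
      a * b * r ^ 2 + (a * pB + b * pA) * r + b * (wA + wB) +
        (4 * m ^ 2 + 10 * m * W + W ^ 2) := by
  have hW0 : 0 ≤ W := by linarith
  set q : ℝ := 1 / (r - m) with hq
  have hq0 : 0 ≤ q := by positivity
  have hq1 : q ≤ 1 := (div_le_one (by linarith)).2 hrm
  have hrq : r * q = 1 + m * q := by
    have : (r - m) * q = 1 := mul_one_div_cancel (by linarith)
    linarith
  have hbq : b * q ≤ 6 := by
    rw [hq, mul_one_div, div_le_iff₀ (by linarith)]
    exact hbr
  have e1 : (a * r + pA + wA / (r - m)) * (b * r + pB + wB / (r - m)) =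
      a * b * r ^ 2 + (a * pB + b * pA) * r + (a * wB + b * wA) * (r * q) + pA * pB
        + (pA * wB + pB * wA) * q + wA * wB * q ^ 2 := by
    have : ∀ w : ℝ, w / (r - m) = w * q := fun w => by rw [hq, mul_one_div]
    rw [this, this]; ring
  rw [e1, hrq]
  have t1 : (a * wB + b * wA) * (1 + m * q) ≤ b * (wA + wB) + 6 * m * W := by
    have s1 : (a * wB + b * wA : ℝ) ≤ b * (wA + wB) := by
      linarith [mul_le_mul_of_nonneg_right habR hwB0]
    have s2 : (0 : ℝ) ≤ 1 + m * q := by positivity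
    have s3 := mul_le_mul_of_nonneg_right s1 s2
    have s4 : b * q * (m * (wA + wB)) ≤ 6 * (m * W) := by gcongr
    linarith
  have t2 : (pA : ℝ) * pB ≤ 4 * m ^ 2 := by
    calc (pA : ℝ) * pB ≤ (2 * m) * (2 * m) :=
          mul_le_mul (by linarith) (by linarith) hpB0 (by linarith)
      _ = _ := by ring
  have t3 : (pA * wB + pB * wA) * q ≤ 4 * m * W := by
    have s1 : (pA * wB + pB * wA : ℝ) ≤ (pA + pB) * (wA + wB) := by
      linarith [mul_nonneg hpA0 hwA0, mul_nonneg hpB0 hwB0]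
    have s2 : ((pA : ℝ) + pB) * (wA + wB) ≤ 2 * m * W := by gcongr
    have s3 : (pA * wB + pB * wA) * q ≤ (2 * m * W) * 1 := by gcongr; linarith
    linarith [mul_nonneg hm0 hW0]
  have t4 : wA * wB * q ^ 2 ≤ W ^ 2 := by
    have s1 : (wA * wB : ℝ) ≤ W ^ 2 := by
      rw [sq]; exact mul_le_mul (by linarith) (by linarith) hwB0 hW0
    have s2 : q ^ 2 ≤ 1 := pow_le_one₀ hq0 hq1
    calc wA * wB * q ^ 2 ≤ W ^ 2 * 1 := by gcongr
      _ = _ := mul_one _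
  linarith

/-- Numerical comparison of the spectral bounds. -/
lemma eq_of_spectral_bounds (m E : ℕ) : ∃ K : ℝ, ∀ (a b n e pA pB wA wB : ℕ) (r : ℝ),
    a ≤ b → a + b = n → n ≤ 2 * a + E → (n : ℝ) ≤ 2 * r + 1 → K ≤ r → K ≤ n →
    ((n - n / 2 : ℕ) : ℝ) * ((n / 2 : ℕ) * r ^ 2 + (2 * m * r + m * (m + 1))) ≤ r ^ 4 →
    r ^ 4 ≤ (a * r + pA + wA / (r - m)) * (b * r + pB + wB / (r - m)) →
    pA + pB = 2 * e → e ≤ m → wA + wB ≤ e * (e + 1) →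
    a = n / 2 ∧ e = m ∧ wA + wB = e * (e + 1) ∧ (a = b ∨ pB = 0) := by
  set W : ℝ := m * (m + 1) with hW
  set K₁ : ℝ := 4 * m ^ 2 + 10 * m * W + W ^ 2 with hK₁
  refine ⟨2 * K₁ + 2 * m * E + 3 * W + 2 * m + 2, ?_⟩
  intro a b n e pA pB wA wB r hab hn hE hnr hKr hKn hlow hup hp he hw
  have hm0 : (0 : ℝ) ≤ m := Nat.cast_nonneg m
  have hE0 : (0 : ℝ) ≤ E := Nat.cast_nonneg E
  have hmE : (0 : ℝ) ≤ m * E := by positivity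
  have hW0 : 0 ≤ W := by positivity
  have hK0 : 0 ≤ K₁ := by positivity
  have hr1 : 1 ≤ r := by linarith
  have hr0 : 0 < r := by linarith
  have hrm : 1 ≤ r - m := by linarith
  have hpR : (pA : ℝ) + pB = 2 * e := by exact_mod_cast hp
  have heR : (e : ℝ) ≤ m := by exact_mod_cast he
  have hwR : (wA : ℝ) + wB ≤ e * (e + 1) := by exact_mod_cast hw
  have habR : (a : ℝ) ≤ b := by exact_mod_cast hab
  have hnR : (a : ℝ) + b = n := by exact_mod_cast hn
  have hER : (n : ℝ) ≤ 2 * a + E := by exact_mod_cast hE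
  have ha0 : (0 : ℝ) ≤ a := Nat.cast_nonneg a
  have hpA0 : (0 : ℝ) ≤ pA := Nat.cast_nonneg pA
  have hpB0 : (0 : ℝ) ≤ pB := Nat.cast_nonneg pB
  have hwA0 : (0 : ℝ) ≤ wA := Nat.cast_nonneg wA
  have hwB0 : (0 : ℝ) ≤ wB := Nat.cast_nonneg wB
  have he0 : (0 : ℝ) ≤ e := Nat.cast_nonneg e
  have hb3 : (b : ℝ) ≤ 3 * r := by linarith
  have hwW : (wA : ℝ) + wB ≤ W := hwR.trans (by rw [hW]; gcongr)
  have hup' : r ^ 4 ≤ a * b * r ^ 2 + (a * pB + b * pA) * r + b * (wA + wB) + K₁ := by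
    refine hup.trans ((mul_le_of_small_corrections habR hm0 hpA0 hpB0 hwA0 hwB0 hrm ?_
      (by linarith) hwW).trans_eq (by rw [hK₁]))
    linarith
  have hbal : a = n / 2 := by
    by_contra hne
    have hprod : a * b + 1 ≤ (n - n / 2) * (n / 2) := by
      obtain ⟨d, hd⟩ : ∃ d, n / 2 = a + 1 + d := ⟨n / 2 - (a + 1), by omega⟩
      obtain ⟨f, hf⟩ : ∃ f, n - n / 2 = a + 1 + d + f := ⟨n - n / 2 - n / 2, by omega⟩
      have : b = a + 2 + 2 * d + f := by omega
      rw [hf, hd, this]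
      nlinarith
    have hprodR : (a : ℝ) * b + 1 ≤ ((n - n / 2 : ℕ) : ℝ) * (n / 2 : ℕ) := by exact_mod_cast hprod
    have hbstar : (b : ℝ) ≤ ((n - n / 2 : ℕ) : ℝ) + E := by
      have : b ≤ n - n / 2 + E := by omega
      exact_mod_cast this
    set β : ℝ := ((n - n / 2 : ℕ) : ℝ)
    have hβ : 0 ≤ β := Nat.cast_nonneg _
    have s1 : (a * pB + b * pA : ℝ) ≤ (β + E) * (2 * m) := by
      have h1 : (b : ℝ) * (pA + pB) ≤ b * (2 * m) :=
        mul_le_mul_of_nonneg_left (by linarith) (by linarith)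
      have : (a * pB + b * pA : ℝ) ≤ b * (2 * m) := by
        linarith [mul_le_mul_of_nonneg_right habR hpB0]
      exact this.trans (by gcongr)
    have s2 : (b : ℝ) * (wA + wB) ≤ 3 * r * W := by gcongr
    have s3 := mul_le_mul_of_nonneg_right s1 hr0.le
    have s4 := mul_le_mul_of_nonneg_right hprodR (sq_nonneg r)
    have s5 : r ^ 2 ≤ 2 * m * E * r + 3 * r * W + K₁ := by
      linarith [mul_nonneg hβ hW0]
    have s6 : K₁ ≤ K₁ * r := le_mul_of_one_le_right hK0 hr1
    have s7 : (2 * m * E + 3 * W + K₁) * r < r * r :=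
      mul_lt_mul_of_pos_right (by linarith) hr0
    linarith
  have hb : n - n / 2 = b := by omega
  rw [hb, ← hbal] at hlow
  have hbn : (n : ℝ) ≤ 2 * b := by linarith
  have hthin : (b - a) * pB * r + b * (2 * (m - e)) * r + b * (W - (wA + wB)) ≤ K₁ := by
    have hpA : (pA : ℝ) = 2 * e - pB := by linarith
    rw [hpA] at hup'
    linarith
  have hb0 : (0 : ℝ) < b := by linarith
  have u1 : 0 ≤ ((b : ℝ) - a) * pB * r := by
    have : (0 : ℝ) ≤ b - a := by linarith
    positivity
  have u2 : 0 ≤ (b : ℝ) * (2 * (m - e)) * r := by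
    have : (0 : ℝ) ≤ m - e := by linarith
    positivity
  have u3 : 0 ≤ (b : ℝ) * (W - (wA + wB)) := mul_nonneg hb0.le (by linarith)
  have hem : e = m := by
    by_contra hne
    have : (e : ℝ) + 1 ≤ m := by exact_mod_cast (by omega : e + 1 ≤ m)
    have : (b : ℝ) * 2 * 1 ≤ b * (2 * (m - e)) * r := by
      gcongr
      linarith
    linarith
  refine ⟨hbal, hem, ?_, ?_⟩
  · by_contra hne
    have h1 : wA + wB + 1 ≤ m * (m + 1) := by
      rw [hem] at hw hne; omega
    have h2 : (wA : ℝ) + wB + 1 ≤ W := by rw [hW]; exact_mod_cast h1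
    have : (b : ℝ) * 1 ≤ b * (W - (wA + wB)) := by gcongr; linarith
    linarith
  · by_contra! hne
    have h1 : (a : ℝ) + 1 ≤ b := by exact_mod_cast (by omega : a + 1 ≤ b)
    have h2 : (1 : ℝ) ≤ pB := by exact_mod_cast Nat.one_le_iff_ne_zero.2 hne.2
    have : 1 * 1 * r ≤ ((b : ℝ) - a) * pB * r := by gcongr; linarith
    linarith

lemma cliqueGraph_adj {W : Type*} {S : Finset W} {u v : W} :
    (cliqueGraph S).Adj u v ↔ u ≠ v ∧ u ∈ S ∧ v ∈ S := Iff.rfl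

lemma card_edgeFinset_cliqueGraph {T : Finset V} (hT : #T = 3) :
    #(cliqueGraph T).edgeFinset = 3 := by
  obtain ⟨a, b, c, hab, hac, hbc, rfl⟩ := card_eq_three.1 hT
  refine card_eq_three.2 ⟨s(a, b), s(a, c), s(b, c), ?_, ?_, ?_, ?_⟩
  · simp only [ne_eq, Sym2.eq_iff]; grind
  · simp only [ne_eq, Sym2.eq_iff]; grind
  · simp only [ne_eq, Sym2.eq_iff]; grind
  · ext e
    induction e with
    | _ u v =>
      simp only [SimpleGraph.mem_edgeFinset, SimpleGraph.mem_edgeSet, cliqueGraph_adj, mem_insert,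
        mem_singleton, Sym2.eq_iff]
      grind

lemma not_hasEdgeDisjointTriangles_crossGraph_sup {A : Finset V} {H : SimpleGraph V} {k : ℕ}
    (hH : ∀ u v, H.Adj u v → (u ∈ A ↔ v ∈ A)) (hk : #H.edgeFinset < k) :
    ¬ HasEdgeDisjointTriangles (crossGraph A ⊔ H) k := by
  refine not_hasEdgeDisjointTriangles_of_within (A := A) ?_
  convert hk
  exact withinGraph_sup hH

lemma starGraph_within {W : Type*} {A L : Finset W} {c : W} (hc : c ∈ A) (hL : L ⊆ A) (u v : W)
    (h : (starGraph c L).Adj u v) : u ∈ A ↔ v ∈ A := by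
  rcases h.2 with ⟨rfl, hv⟩ | ⟨rfl, hu⟩
  · exact iff_of_true hc (hL hv)
  · exact iff_of_true (hL hu) hc

lemma cliqueGraph_within {W : Type*} {A T : Finset W} (hT : T ⊆ A) (u v : W)
    (h : (cliqueGraph T).Adj u v) : u ∈ A ↔ v ∈ A :=
  iff_of_true (hT h.2.1) (hT h.2.2)

/-- The lower bound for the extremal spectral radius given by a star embedded in a balanced
complete bipartite graph. -/
lemma exists_le_specRad_of_maximal {n m : ℕ} (hn : Fintype.card V = n) (hmn : m < n / 2) :
    ∃ r : ℝ, (n : ℝ) ≤ 2 * r + 1 ∧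
      ((n - n / 2 : ℕ) : ℝ) * ((n / 2 : ℕ) * r ^ 2 + (2 * m * r + m * (m + 1))) ≤ r ^ 4 ∧
      ∀ G : SimpleGraph V, (∀ G' : SimpleGraph V, ¬ HasEdgeDisjointTriangles G' (m + 1) →
        specRad G' ≤ specRad G) → r ≤ specRad G := by
  obtain ⟨A, -, hA⟩ := exists_subset_card_eq (s := (univ : Finset V)) (n := n / 2)
    (by rw [card_univ]; omega)
  obtain ⟨c, hc⟩ : A.Nonempty := card_pos.1 (by omega)
  obtain ⟨L, hL, hLm⟩ := exists_subset_card_eq (s := A.erase c) (n := m)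
    (by rw [card_erase_of_mem hc]; omega)
  have hcL : c ∉ L := fun h => notMem_erase c A (hL h)
  have hLA : L ⊆ A := hL.trans (erase_subset c A)
  have hAc : #Aᶜ = n - n / 2 := by rw [card_compl, hn, hA]
  obtain ⟨h0, h1, h2⟩ := specRad_star hc hcL hLA (card_pos.1 (by omega)) rfl
  rw [hA, hAc, hLm] at h2
  rw [hA, hAc] at h1
  set r := specRad (crossGraph A ⊔ starGraph c L)
  refine ⟨r, ?_, ?_, fun G hG => hG _ ?_⟩
  · have hprod : n ^ 2 ≤ 4 * ((n / 2) * (n - n / 2)) + 1 := by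
      obtain ⟨d, hd | hd⟩ := Nat.even_or_odd' n
      · have e1 : n / 2 = d := by omega
        have e2 : n - n / 2 = d := by omega
        rw [e2, e1, hd]; nlinarith
      · have e1 : n / 2 = d := by omega
        have e2 : n - n / 2 = d + 1 := by omega
        rw [e2, e1, hd]; nlinarith
    have hprodR : (n : ℝ) ^ 2 ≤ 4 * (((n / 2 : ℕ) : ℝ) * ((n - n / 2 : ℕ) : ℝ)) + 1 := by
      exact_mod_cast hprod
    have hn1 : (1 : ℝ) ≤ n := by exact_mod_cast (by omega : 1 ≤ n)
    by_contra! hlt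
    nlinarith
  · have hm0 : (0 : ℝ) ≤ m := Nat.cast_nonneg m
    have := mul_nonneg (sub_nonneg.2 h1) hm0
    linarith
  · exact not_hasEdgeDisjointTriangles_crossGraph_sup (starGraph_within hc hLA)
      ((card_edgeFinset_starGraph_le c L).trans_lt (by omega))

/-- The structure of extremal graphs, given a near balanced bipartition spanning all cross
edges. -/
lemma exists_structure_of_maximal {n m E : ℕ} {K : ℝ} (hm : 1 ≤ m)
    (hK : ∀ (a b n e pA pB wA wB : ℕ) (r : ℝ),
      a ≤ b → a + b = n → n ≤ 2 * a + E → (n : ℝ) ≤ 2 * r + 1 → K ≤ r → K ≤ n →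
      ((n - n / 2 : ℕ) : ℝ) * ((n / 2 : ℕ) * r ^ 2 + (2 * m * r + m * (m + 1))) ≤ r ^ 4 →
      r ^ 4 ≤ (a * r + pA + wA / (r - m)) * (b * r + pB + wB / (r - m)) →
      pA + pB = 2 * e → e ≤ m → wA + wB ≤ e * (e + 1) →
      a = n / 2 ∧ e = m ∧ wA + wB = e * (e + 1) ∧ (a = b ∨ pB = 0))
    (hn : Fintype.card V = n) (hmn : 2 * m + 2 ≤ n) (hEn : E < n) (hKn : 2 * K + 1 ≤ n) (hKn' : K ≤ n)
    {A : Finset V} {H : SimpleGraph V} (hH : ∀ u v, H.Adj u v → (u ∈ A ↔ v ∈ A))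
    (hmax : ∀ G' : SimpleGraph V, ¬ HasEdgeDisjointTriangles G' (m + 1) →
      specRad G' ≤ specRad (crossGraph A ⊔ H))
    {x : V → ℝ} (hx : ∀ v, 0 < x v)
    (heig : ∀ v, nbrSum (crossGraph A ⊔ H) x v = specRad (crossGraph A ⊔ H) * x v)
    (hHm : #H.edgeFinset ≤ m) (hA : n ≤ 2 * #A + E) (hA' : n ≤ 2 * #Aᶜ + E) :
    ∃ A' : Finset V, #A' = n / 2 ∧ crossGraph A' = crossGraph A ∧ #H.edgeFinset = m ∧
      ((∃ c L, c ∈ A' ∧ c ∉ L ∧ L ⊆ A' ∧ #L = m ∧ H = starGraph c L) ∨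
        ∃ T, T ⊆ A' ∧ #T = 3 ∧ m = 3 ∧ H = cliqueGraph T) := by
  wlog hle : #A ≤ #Aᶜ generalizing A with hwlog
  · have hcc := crossGraph_compl A
    obtain ⟨A', h1, h2, h3⟩ := hwlog (A := Aᶜ)
      (fun u v huv => by simpa [mem_compl, not_iff_not] using hH u v huv)
      (by rwa [hcc]) (by rwa [hcc]) hA' (by rwa [compl_compl]) (by rw [compl_compl]; omega)
    exact ⟨A', h1, h2.trans hcc, h3⟩
  obtain ⟨r, hr1, hr2, hr3⟩ := exists_le_specRad_of_maximal (m := m) hn (by omega)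
  have hsum : #A + #Aᶜ = n := by rw [card_add_card_compl, hn]
  have hmr : (m : ℝ) < r := by
    have : (2 * m + 2 : ℝ) ≤ n := by exact_mod_cast hmn
    linarith
  have hup := pow_four_le_of_le_specRad hH hx (card_pos.1 (by omega)) (card_pos.1 (by omega)) hHm
    hmr (hr3 _ hmax) heig
  obtain ⟨ha, he, hw, hside⟩ := hK _ _ n #H.edgeFinset _ _ _ _ r hle hsum hA hr1 (by linarith)
    hKn' hr2 hup
    (by rw [sum_add_sum_compl, SimpleGraph.sum_degrees_eq_twice_card_edges]) hHm
    (by rw [sum_add_sum_compl]; exact sum_degree_sq_le H)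
  rw [sum_add_sum_compl] at hw
  have hinc : ∀ v, H.degree v ≤ #H.edgeFinset := fun v => by
    rw [← H.card_incidenceFinset_eq_degree]
    exact card_le_card (H.incidenceFinset_subset v)
  have hint : ∀ a b c d, H.Adj a b → H.Adj c d → c = a ∨ c = b ∨ d = a ∨ d = b :=
    fun a b c d hab hcd => intersecting_of_sum_degree_sq hw hab hcd
  obtain ⟨p, q, hpq⟩ : ∃ p q, H.Adj p q := by
    obtain ⟨e, he⟩ : H.edgeFinset.Nonempty := card_pos.1 (by omega)
    induction e with
    | _ p q => exact ⟨p, q, by simpa using he⟩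
  have hall : ∀ B : Finset V, (∀ u v, H.Adj u v → (u ∈ B ↔ v ∈ B)) → p ∈ B →
      ∀ u v, H.Adj u v → u ∈ B := by
    intro B hB hp u v huv
    have hq := (hB p q hpq).1 hp
    have := hB u v huv
    rcases hint p q u v hpq huv with rfl | rfl | rfl | rfl
    exacts [hp, hq, this.2 hp, this.2 hq]
  obtain ⟨A', hA'1, hA'2, hA'3⟩ : ∃ A' : Finset V, #A' = n / 2 ∧ crossGraph A' = crossGraph A ∧
      ∀ u v, H.Adj u v → u ∈ A' := by
    by_cases hp : p ∈ A
    · exact ⟨A, ha, rfl, hall A hH hp⟩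
    · refine ⟨Aᶜ, ?_, crossGraph_compl A, hall Aᶜ
        (fun u v huv => by simpa [mem_compl, not_iff_not] using hH u v huv) (mem_compl.2 hp)⟩
      rcases hside with h | h
      · omega
      · have h1 := sum_eq_zero_iff.1 h p (mem_compl.2 hp)
        have h2 := (H.degree_pos_iff_exists_adj p).2 ⟨q, hpq⟩
        omega
  refine ⟨A', hA'1, hA'2, he, ?_⟩
  have hcongr : ∀ H' : SimpleGraph V, H = H' → #H.edgeFinset = #H'.edgeFinset := by
    rintro _ rfl; rfl
  rcases star_or_triangle hpq hint with ⟨c, hc⟩ | ⟨T, hT3, hT⟩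
  · have hcard := card_edgeFinset_starGraph_le c (H.neighborFinset c)
    have hdeg := hinc c
    rw [← SimpleGraph.card_neighborFinset_eq_degree] at hdeg
    have hcm : #(H.neighborFinset c) = m := by
      refine le_antisymm (hdeg.trans hHm) ?_
      rw [← he, hcongr _ hc]
      exact hcard
    obtain ⟨w, hw⟩ : (H.neighborFinset c).Nonempty := card_pos.1 (by omega)
    rw [SimpleGraph.mem_neighborFinset] at hw
    refine Or.inl ⟨c, H.neighborFinset c, hA'3 c w hw, ?_, fun v hv => ?_, hcm, hc⟩
    · simp
    · exact hA'3 v c ((H.mem_neighborFinset c v).1 hv).symm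
  · refine Or.inr ⟨T, fun v hv => ?_, hT3, ?_, hT⟩
    · obtain ⟨w, hw, hne⟩ := exists_mem_ne (by omega : 1 < #T) v
      refine hA'3 v w ?_
      rw [hT]
      exact ⟨hne.symm, hv, hw⟩
    · rw [← he, hcongr _ hT, card_edgeFinset_cliqueGraph hT3]

/-- An extremal graph is a balanced complete bipartite graph with a star or a triangle embedded
in a part of size `n / 2`. -/
lemma exists_eq_crossGraph_sup_of_maximal (m : ℕ) (hm : 1 ≤ m) :
    ∃ n₀ : ℕ, ∀ n : ℕ, n₀ ≤ n → ∀ (V : Type) (_ : Fintype V) (G : SimpleGraph V),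
      Fintype.card V = n → ¬ HasEdgeDisjointTriangles G (m + 1) →
      (∀ G' : SimpleGraph V, ¬ HasEdgeDisjointTriangles G' (m + 1) → specRad G' ≤ specRad G) →
      2 < specRad G ∧ ∃ (A : Finset V) (H : SimpleGraph V), m < #A ∧ #A = n / 2 ∧ Aᶜ.Nonempty ∧
        #H.edgeFinset = m ∧ G = crossGraph A ⊔ H ∧
        ((∃ c L, c ∈ A ∧ c ∉ L ∧ L ⊆ A ∧ #L = m ∧ H = starGraph c L) ∨
          ∃ T, T ⊆ A ∧ #T = 3 ∧ m = 3 ∧ H = cliqueGraph T) := by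
  set D : ℕ := 4 * (m + 1) + 3 with hD
  set E : ℕ := D + 2 * (2 * D + 3 * (m + 1)) with hE
  obtain ⟨K, hK⟩ := eq_of_spectral_bounds m E
  refine ⟨⌈2 * |K| + 1⌉₊ + 6 * (m + 1) + 5 * D + 3 * E + 10, ?_⟩
  intro n hn V _ G hV hG hmax
  have hK1 : 2 * |K| + 1 ≤ n := (Nat.le_ceil _).trans (by exact_mod_cast (by omega))
  have hKabs := le_abs_self K
  have hKabs' := abs_nonneg K
  have : Nonempty V := Fintype.card_pos_iff.1 (by omega)
  obtain ⟨r, hr, -, hle⟩ := exists_le_specRad_of_maximal (m := m) hV (by omega)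
  have hs : (n : ℝ) ≤ 2 * specRad G + 1 := hr.trans (by linarith [hle G hmax])
  have hn1 : (4 * m + 10 : ℝ) ≤ n := by exact_mod_cast (by omega : 4 * m + 10 ≤ n)
  have hm0 : (0 : ℝ) ≤ m := Nat.cast_nonneg m
  have hdegree : ∀ d : ℕ, specRad G - 2 * (m + 1 : ℕ) - 1 ≤ d → n ≤ 2 * d + D := by
    intro d hd
    have : (n : ℝ) ≤ 2 * d + (4 * (m + 1) + 3) := by push_cast at hd; linarith
    rw [hD]
    exact_mod_cast this
  obtain ⟨x, hx, heig, hdeg, I, hI, hIcard⟩ := exists_large_independent hG hmax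
    (by push_cast; linarith)
  have hdeg' := fun v => hdegree _ (hdeg v)
  obtain ⟨A, hA, hA', hwithin⟩ := exists_partition (by omega) hG hV (by omega) hdeg' hI
    (hdegree _ hIcard)
  obtain ⟨hAn, hAn', hcommon⟩ := balanced_of_within_le hV hdeg' hA hA' hwithin
  have hedges := card_within_lt (A := A) hG fun a b hab => by
    have := hcommon a b hab
    omega
  have hwith : ∀ u v, (withinGraph G A).Adj u v → (u ∈ A ↔ v ∈ A) := fun u v h =>
    (withinGraph_adj.1 h).2
  have hGeq : G = crossGraph A ⊔ withinGraph G A :=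
    eq_of_le_of_specRad_le hx heig (crossGraph_sup_withinGraph_ge G A)
      (hmax _ (not_hasEdgeDisjointTriangles_crossGraph_sup hwith hedges))
  obtain ⟨H, hH⟩ : ∃ H, H = withinGraph G A := ⟨_, rfl⟩
  rw [← hH] at hGeq hwith
  have hHm : #H.edgeFinset ≤ m := by subst hH; omega
  clear hH
  subst hGeq
  refine ⟨by linarith, ?_⟩
  obtain ⟨A', hA'n, hcross, hstr⟩ := exists_structure_of_maximal hm hK hV (by omega) (by omega)
    (by linarith) (by linarith) hwith hmax hx heig hHm hAn hAn'
  have hA'c : 0 < #A'ᶜ := by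
    rw [card_compl, hV]; omega
  exact ⟨A', H, by omega, hA'n, card_pos.1 hA'c, hstr.1, by rw [hcross], hstr.2⟩

end

theorem stmt19 (k : ℕ) (hk : 2 ≤ k) :
    ∃ n₀ : ℕ, ∀ n : ℕ, n₀ ≤ n →
      ∀ (V : Type) (_ : Fintype V) (G : SimpleGraph V), Fintype.card V = n →
        ¬ HasEdgeDisjointTriangles G k →
        (∀ G' : SimpleGraph V, ¬ HasEdgeDisjointTriangles G' k →
          specRad G' ≤ specRad G) →
        Nonempty (G ≃g (if k = 4 then bipTri n else bipStar n k)) ∧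
          G.edgeSet.ncard = n ^ 2 / 4 + k - 1 := by
  classical
  obtain ⟨m, rfl⟩ : ∃ m, k = m + 1 := ⟨k - 1, by omega⟩
  obtain ⟨n₀, hn₀⟩ := exists_eq_crossGraph_sup_of_maximal m (by omega)
  refine ⟨n₀, fun n hn V _ G hV hG hmax => ?_⟩
  obtain ⟨h2, A, H, hmA, hA, hA', hHm, rfl, hstr⟩ := hn₀ n hn V _ G hV hG hmax
  have hH : ∀ u v, H.Adj u v → (u ∈ A ↔ v ∈ A) := by
    rcases hstr with ⟨c, L, hc, -, hL, -, rfl⟩ | ⟨T, hT, -, -, rfl⟩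
    · exact starGraph_within hc hL
    · exact cliqueGraph_within hT
  constructor
  · rcases hstr with ⟨c, L, hc, hcL, hL, hLm, rfl⟩ | ⟨T, hT, hT3, hm3, rfl⟩
    · have hk4 : m + 1 ≠ 4 := by
        intro h4
        obtain ⟨T, hT, hT3⟩ := Finset.exists_subset_card_eq (s := A) (n := 3) (by omega)
        refine (hmax (crossGraph A ⊔ cliqueGraph T) ?_).not_gt
          (specRad_star_lt_specRad_clique hc hcL hL (by omega) hT hT3 hA' h2)
        refine not_hasEdgeDisjointTriangles_crossGraph_sup (cliqueGraph_within hT) ?_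
        rw [card_edgeFinset_cliqueGraph hT3]
        omega
      rw [if_neg hk4]
      exact nonempty_iso_bipStar hV (by omega) hA hc hcL hL (by omega)
    · rw [if_pos (by omega)]
      exact nonempty_iso_bipTri hV hA hT hT3
  · have hcard := card_edgeFinset_crossGraph_sup hH
    rw [hHm, Finset.card_compl, hV, hA] at hcard
    have hsq : n / 2 * (n - n / 2) = n ^ 2 / 4 := by
      obtain ⟨d, hd | hd⟩ := Nat.even_or_odd' n
      · have e1 : n / 2 = d := by omega
        have e2 : n - n / 2 = d := by omega
        rw [e2, e1, hd]
        have : (2 * d) ^ 2 = 4 * (d * d) := by ring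
        omega
      · have e1 : n / 2 = d := by omega
        have e2 : n - n / 2 = d + 1 := by omega
        rw [e2, e1, hd]
        have : (2 * d + 1) ^ 2 = 4 * (d * (d + 1)) + 1 := by ring
        omega
    rw [← SimpleGraph.coe_edgeFinset, Set.ncard_coe_finset, hcard, hsq]
    omega
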